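/- arXiv:1809.05593 — 3 statements merged into one kernel-verified Lean document; each statement's English description precedes it below -/
import Mathlib

section
/- Let H = {x ∈ ℝ⁴ : x₁ > 0} be the open upper half-space and let u be a real-valued function that is smooth on an open neighborhood of the closed half-space H̄ = {x ∈ ℝ⁴ : x₁ ≥ 0}. Assume: (i) Δ²u = 0 on H (u is biharmonic); (ii) −Δu − |∇u|² ≥ 0 on H; (iii) x₁·Δu(x) = 2·∂₁u(x) for every x ∈ H; (iv) at every boundary point x with x₁ = 0 one has u(x) = 0, ∇u(x) = 0 and Δu(x) = 0. Then u is identically zero on H̄. (This is the analytic core of the paper's Proposition stating that there is no boundary blow-up: the conformal factor u = w₂ − w₁ between the limit Fefferman–Graham compactification and the flat metric on the half-space model satisfies (i) because the limit metric is Q₄-flat, (ii) because its scalar curvature is non-negative, (iii) because u is harmonic for the hyperbolic metric, and (iv) because the boundary metric is Euclidean with totally geodesic boundary and vanishing boundary scalar curvature; the conclusion says the limit metric is flat.) -/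
/-- The Euclidean Laplacian on `ℝ⁴`: the sum of the pure second partial derivatives. -/
noncomputable def lap (u : EuclideanSpace ℝ (Fin 4) → ℝ) (x : EuclideanSpace ℝ (Fin 4)) : ℝ :=
  ∑ i : Fin 4,
    iteratedFDeriv ℝ 2 u x ![EuclideanSpace.single i (1 : ℝ), EuclideanSpace.single i (1 : ℝ)]

namespace NB

open MeasureTheory Set

abbrev E4 := Fin 4 → ℝ

noncomputable def lo (R : ℝ) : E4 := fun i => if i = 0 then 0 else -R
noncomputable def hi (R : ℝ) : E4 := fun _ => R
noncomputable def box (R : ℝ) : Set E4 := Set.pi univ fun i => Ioo (lo R i) (hi R i)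

lemma box_open (R : ℝ) : IsOpen (box R) := isOpen_set_pi finite_univ fun _ _ => isOpen_Ioo

lemma box_sub (R : ℝ) : box R ⊆ Icc (lo R) (hi R) := by
  intro x hx
  exact ⟨fun i => (hx i trivial).1.le, fun i => (hx i trivial).2.le⟩

lemma box_pos {R : ℝ} {x : E4} (hx : x ∈ box R) : 0 < x 0 := by
  have := (hx 0 trivial).1
  simpa [lo] using this

lemma box_abs {R : ℝ} (hR : 0 < R) {x : E4} (hx : x ∈ box R) (i : Fin 4) : |x i| ≤ R := by
  have h := hx i trivial
  simp only [lo, hi, mem_Ioo] at h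
  rw [abs_le]
  split_ifs at h <;> constructor <;> linarith [h.1, h.2]

lemma box_mono {L R : ℝ} (h : L ≤ R) : box L ⊆ box R := by
  intro x hx i _
  have h' := hx i trivial
  simp only [lo, hi, mem_Ioo] at h' ⊢
  split_ifs at h' ⊢ <;> constructor <;> linarith [h'.1, h'.2]

lemma lo_le_hi {R : ℝ} (hR : 0 < R) : lo R ≤ hi R := by
  intro i
  simp only [lo, hi]
  split_ifs <;> linarith

lemma Icc_half {R : ℝ} {x : E4} (hx : x ∈ Icc (lo R) (hi R)) : 0 ≤ x 0 := by
  have := hx.1 0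
  simpa [lo] using this

lemma box_ae (R : ℝ) : box R =ᵐ[volume] Icc (lo R) (hi R) := by
  rw [volume_pi]
  exact Measure.univ_pi_Ioo_ae_eq_Icc

lemma box_vol {R : ℝ} (hR : 0 < R) : volume.real (box R) = 8 * R ^ 4 := by
  rw [measureReal_def, measure_congr (box_ae R), Real.volume_Icc_pi_toReal (lo_le_hi hR)]
  simp [Fin.prod_univ_four, lo, hi]
  ring

lemma intOn {R : ℝ} {U : Set E4} (hU : {x : E4 | 0 ≤ x 0} ⊆ U) {f : E4 → ℝ}
    (hf : ContinuousOn f U) : IntegrableOn f (box R) := by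
  have : ContinuousOn f (Icc (lo R) (hi R)) := hf.mono fun x hx => hU (Icc_half hx)
  exact (this.integrableOn_compact isCompact_Icc).mono_set (box_sub R)

/-- Divergence theorem on the box for fields with vanishing normal component. -/
lemma div_zero {R : ℝ} (hR : 0 < R) {U : Set E4} (hUo : IsOpen U)
    (hU : {x : E4 | 0 ≤ x 0} ⊆ U) (F D : Fin 4 → E4 → ℝ)
    (hF : ∀ i, ContDiffOn ℝ 1 (F i) U)
    (hD : ∀ i, ∀ x ∈ box R, HasLineDerivAt ℝ (F i) (D i x) x (Pi.single i 1))
    (h0 : ∀ x : E4, x 0 = 0 → F 0 x = 0)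
    (h1 : ∀ i, ∀ x : E4, 0 ≤ x 0 → |x i| = R → F i x = 0) :
    ∫ x in box R, ∑ i, D i x = 0 := by
  have hsub : Icc (lo R) (hi R) ⊆ U := fun x hx => hU (Icc_half hx)
  have hdiff : ∀ i, ∀ x ∈ U, DifferentiableAt ℝ (F i) x := fun i x hx =>
    ((hF i).differentiableOn (by norm_num)).differentiableAt (hUo.mem_nhds hx)
  have hcont : ∀ i, ContinuousOn (fun x => fderiv ℝ (F i) x (Pi.single i 1)) U := fun i =>
    ((hF i).continuousOn_fderiv_of_isOpen hUo le_rfl).clm_apply continuousOn_const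
  have key := integral_divergence_of_hasFDerivAt_off_countable' (lo R) (hi R) (lo_le_hi hR) F
    (fun i x => fderiv ℝ (F i) x) ∅ countable_empty
    (fun i => (hF i).continuousOn.mono hsub)
    (fun x hx i => (hdiff i x (hsub (box_sub R hx.1))).hasFDerivAt)
    ((continuousOn_finsetSum _ fun i _ => (hcont i).mono hsub).integrableOn_compact isCompact_Icc)
  have hz : ∀ i : Fin 4, ∀ y ∈ Icc (lo R ∘ i.succAbove) (hi R ∘ i.succAbove),
      F i (i.insertNth (hi R i) y) = 0 ∧ F i (i.insertNth (lo R i) y) = 0 := by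
    intro i y hy
    have hm : ∀ c ∈ Icc (lo R i) (hi R i),
        (i.insertNth c y : E4) ∈ Icc (lo R) (hi R) := by
      intro c hc
      rw [Fin.insertNth_mem_Icc]
      exact ⟨hc, hy⟩
    have hle := lo_le_hi hR i
    have A := Icc_half (hm _ ⟨hle, le_rfl⟩)
    have B := Icc_half (hm _ ⟨le_rfl, hle⟩)
    refine ⟨h1 i _ A (by simp [hi, abs_of_pos hR]), ?_⟩
    by_cases h : i = 0
    · subst h
      exact h0 _ (by simp [lo])
    · exact h1 i _ B (by simp [lo, h, abs_of_pos hR])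
  rw [setIntegral_congr_set (box_ae R).symm] at key
  rw [setIntegral_congr_fun (g := fun x => ∑ i, fderiv ℝ (F i) x (Pi.single i 1))
    (box_open R).measurableSet ?_, key]
  · refine Finset.sum_eq_zero fun i _ => ?_
    rw [setIntegral_congr_fun (g := fun _ => (0:ℝ)) measurableSet_Icc (fun y hy => (hz i y hy).1),
      setIntegral_congr_fun (g := fun _ => (0:ℝ)) measurableSet_Icc (fun y hy => (hz i y hy).2)]
    simp
  · intro x hx
    refine Finset.sum_congr rfl fun i _ => ?_
    have := (hdiff i x (hsub (box_sub R hx))).hasFDerivAt.hasLineDerivAt (Pi.single i 1)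
    exact (hD i x hx).unique this

lemma ld_mul {f g : E4 → ℝ} {f' g' : ℝ} {x v : E4} (hf : HasLineDerivAt ℝ f f' x v)
    (hg : HasLineDerivAt ℝ g g' x v) :
    HasLineDerivAt ℝ (fun y => f y * g y) (f' * g x + f x * g') x v := by
  have := HasDerivAt.fun_mul hf hg
  simp only [zero_smul, add_zero] at this
  exact this

lemma ld_sub {f g : E4 → ℝ} {f' g' : ℝ} {x v : E4} (hf : HasLineDerivAt ℝ f f' x v)
    (hg : HasLineDerivAt ℝ g g' x v) :
    HasLineDerivAt ℝ (fun y => f y - g y) (f' - g') x v :=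
  HasDerivAt.sub hf hg

lemma ld_add {f g : E4 → ℝ} {f' g' : ℝ} {x v : E4} (hf : HasLineDerivAt ℝ f f' x v)
    (hg : HasLineDerivAt ℝ g g' x v) :
    HasLineDerivAt ℝ (fun y => f y + g y) (f' + g') x v :=
  HasDerivAt.add hf hg

lemma ld_const (c : ℝ) {x v : E4} : HasLineDerivAt ℝ (fun _ : E4 => c) 0 x v :=
  hasDerivAt_const _ _

lemma ld_pow {f : E4 → ℝ} {f' : ℝ} {x v : E4} (n : ℕ) (hf : HasLineDerivAt ℝ f f' x v) :
    HasLineDerivAt ℝ (fun y => f y ^ n) (n * f x ^ (n - 1) * f') x v := by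
  have := HasDerivAt.fun_pow hf n
  simp only [zero_smul, add_zero] at this
  exact this

lemma ld_eq {f : E4 → ℝ} {a b : ℝ} {x v : E4} (hf : HasLineDerivAt ℝ f a x v) (h : a = b) :
    HasLineDerivAt ℝ f b x v := h ▸ hf

lemma ld_coord (j i : Fin 4) (x : E4) :
    HasLineDerivAt ℝ (fun y : E4 => y j) (if j = i then 1 else 0) x (Pi.single i 1) := by
  have h : HasFDerivAt (fun y : E4 => y j) (ContinuousLinearMap.proj (R := ℝ) j) x :=
    (ContinuousLinearMap.proj (R := ℝ) (φ := fun _ : Fin 4 => ℝ) j).hasFDerivAt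
  simpa [Pi.single_apply] using h.hasLineDerivAt (Pi.single i 1)

/-- the cutoff -/
noncomputable def cut (ε : ℝ) (x : E4) : ℝ := ∏ j, (1 - ε * x j ^ 4)
noncomputable def cc (ε : ℝ) (i : Fin 4) (x : E4) : ℝ := ∏ j ∈ Finset.univ.erase i, (1 - ε * x j ^ 4)
noncomputable def cut1 (ε : ℝ) (i : Fin 4) (x : E4) : ℝ := -4 * ε * x i ^ 3 * cc ε i x
noncomputable def cut2 (ε : ℝ) (i : Fin 4) (x : E4) : ℝ := -12 * ε * x i ^ 2 * cc ε i x

lemma cut_eq (ε : ℝ) (i : Fin 4) (x : E4) : cut ε x = (1 - ε * x i ^ 4) * cc ε i x :=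
  (Finset.mul_prod_erase _ _ (Finset.mem_univ i)).symm

lemma ld_cc (ε : ℝ) (i : Fin 4) (x : E4) :
    HasLineDerivAt ℝ (cc ε i) 0 x (Pi.single i 1) := by
  have : (fun t : ℝ => cc ε i (x + t • Pi.single i 1)) = fun _ => cc ε i x := by
    funext t
    refine Finset.prod_congr rfl fun j hj => ?_
    have : j ≠ i := Finset.ne_of_mem_erase hj
    simp [this]
  rw [HasLineDerivAt, this]
  exact hasDerivAt_const _ _

lemma ld_cut (ε : ℝ) (i : Fin 4) (x : E4) :
    HasLineDerivAt ℝ (cut ε) (cut1 ε i x) x (Pi.single i 1) := by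
  have h : cut ε = fun y => (1 - ε * y i ^ 4) * cc ε i y := by funext y; exact cut_eq ε i y
  rw [h]
  refine ld_eq (ld_mul (ld_sub (ld_const 1) (ld_mul (ld_const ε) (ld_pow 4 (ld_coord i i x))))
    (ld_cc ε i x)) ?_
  simp only [cut1, if_true]; push_cast; ring

lemma ld_cut1 (ε : ℝ) (i : Fin 4) (x : E4) :
    HasLineDerivAt ℝ (cut1 ε i) (cut2 ε i x) x (Pi.single i 1) := by
  refine ld_eq (f := cut1 ε i)
    (ld_mul (ld_mul (ld_const (-4 * ε)) (ld_pow 3 (ld_coord i i x))) (ld_cc ε i x)) ?_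
  simp only [cut2, if_true]; push_cast; ring

lemma cd_cut (ε : ℝ) : ContDiff ℝ 1 (cut ε) := by unfold cut; fun_prop
lemma cd_cut1 (ε : ℝ) (i) : ContDiff ℝ 1 (cut1 ε i) := by unfold cut1 cc; fun_prop

noncomputable def q (x : E4) : ℝ := 1 + ∑ j, x j ^ 2
noncomputable def w (x : E4) : ℝ := (q x)⁻¹
lemma q_pos (x : E4) : 0 < q x := by unfold q; positivity
lemma w_pos (x : E4) : 0 < w x := inv_pos.2 (q_pos x)
lemma qw (x : E4) : q x * w x = 1 := mul_inv_cancel₀ (q_pos x).ne'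

lemma ld_q (i : Fin 4) (x : E4) : HasLineDerivAt ℝ q (2 * x i) x (Pi.single i 1) := by
  have h : q = fun y => 1 + (y 0 ^ 2 + y 1 ^ 2 + y 2 ^ 2 + y 3 ^ 2) := by
    funext y; simp [q, Fin.sum_univ_four]
  rw [h]
  have H := fun j => ld_pow 2 (ld_coord j i x)
  convert ld_add (ld_const 1) (ld_add (ld_add (ld_add (H 0) (H 1)) (H 2)) (H 3)) using 1
  fin_cases i <;> simp

lemma ld_w (i : Fin 4) (x : E4) :
    HasLineDerivAt ℝ w (-2 * x i * w x ^ 2) x (Pi.single i 1) := by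
  have := HasDerivAt.fun_inv (ld_q i x) (by simpa using (q_pos x).ne')
  refine ld_eq (f := w) this ?_
  simp only [zero_smul, add_zero, w]; ring

noncomputable def de (i : Fin 4) : ℝ := if 0 = i then 1 else 0
noncomputable def ph (x : E4) : ℝ := x 0 * w x ^ 2
noncomputable def ph1 (i : Fin 4) (x : E4) : ℝ := de i * w x ^ 2 - 4 * (x 0 * x i) * w x ^ 3
noncomputable def ph2 (i : Fin 4) (x : E4) : ℝ :=
  - 4 * de i * x i * w x ^ 3 - 4 * (de i * x i + x 0) * w x ^ 3 + 24 * x 0 * x i ^ 2 * w x ^ 4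

lemma ld_ph (i : Fin 4) (x : E4) : HasLineDerivAt ℝ ph (ph1 i x) x (Pi.single i 1) := by
  refine ld_eq (f := ph) (ld_mul (ld_coord 0 i x) (ld_pow 2 (ld_w i x))) ?_
  simp only [ph1, de]; push_cast; ring

lemma ld_ph1 (i : Fin 4) (x : E4) :
    HasLineDerivAt ℝ (ph1 i) (ph2 i x) x (Pi.single i 1) := by
  refine ld_eq (f := ph1 i) (ld_sub (ld_mul (ld_const (de i)) (ld_pow 2 (ld_w i x)))
    (ld_mul (ld_mul (ld_const 4) (ld_mul (ld_coord 0 i x) (ld_coord i i x)))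
      (ld_pow 3 (ld_w i x)))) ?_
  simp only [ph2, de, if_true]; push_cast; split_ifs <;> ring

lemma ph2_sum (x : E4) : ∑ i, ph2 i x = -24 * x 0 * w x ^ 4 := by
  have h := qw x
  have hw : w x ^ 3 = q x * w x ^ 4 := by linear_combination -w x ^ 3 * h
  simp only [ph2, hw, Fin.sum_univ_four, de]
  simp [q, Fin.sum_univ_four]; ring

lemma cd_w : ContDiff ℝ 1 w := by
  unfold w
  exact ContDiff.inv (by unfold q; fun_prop) fun x => (q_pos x).ne'
lemma cd_ph : ContDiff ℝ 1 ph := by have := cd_w; unfold ph; fun_prop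
lemma cd_ph1 (i) : ContDiff ℝ 1 (ph1 i) := by have := cd_w; unfold ph1; fun_prop

lemma cd_cut2 (ε : ℝ) (i) : Continuous (cut2 ε i) := by unfold cut2 cc; fun_prop
lemma cd_ph2 (i) : Continuous (ph2 i) := by have := cd_w.continuous; unfold ph2; fun_prop

/-! pointwise bounds -/

lemma fac_bd {ε R : ℝ} (hε : 0 < ε) (hεR : ε * R ^ 4 = 1) {t : ℝ} (ht : |t| ≤ R) :
    ε * t ^ 4 ≤ 1 := by
  have : t ^ 4 ≤ R ^ 4 := by
    have := pow_le_pow_left₀ (abs_nonneg t) ht 4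
    rwa [Even.pow_abs (by decide)] at this
  rw [← hεR]; gcongr

lemma cc_bd {ε R : ℝ} (hε : 0 < ε) (hεR : ε * R ^ 4 = 1) {x : E4} (hx : ∀ i, |x i| ≤ R)
    (i : Fin 4) : 0 ≤ cc ε i x ∧ cc ε i x ≤ 1 := by
  have h : ∀ j, 0 ≤ 1 - ε * x j ^ 4 ∧ 1 - ε * x j ^ 4 ≤ 1 := fun j =>
    ⟨by linarith [fac_bd hε hεR (hx j)], by have : 0 ≤ ε * x j ^ 4 := by positivity
                                            linarith⟩
  exact ⟨Finset.prod_nonneg fun j _ => (h j).1,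
    Finset.prod_le_one (fun j _ => (h j).1) fun j _ => (h j).2⟩

lemma cut_bd {ε R : ℝ} (hε : 0 < ε) (hεR : ε * R ^ 4 = 1) {x : E4} (hx : ∀ i, |x i| ≤ R) :
    0 ≤ cut ε x ∧ cut ε x ≤ 1 := by
  have h : ∀ j, 0 ≤ 1 - ε * x j ^ 4 ∧ 1 - ε * x j ^ 4 ≤ 1 := fun j =>
    ⟨by linarith [fac_bd hε hεR (hx j)], by have : 0 ≤ ε * x j ^ 4 := by positivity
                                            linarith⟩
  exact ⟨Finset.prod_nonneg fun j _ => (h j).1,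
    Finset.prod_le_one (fun j _ => (h j).1) fun j _ => (h j).2⟩

lemma cut_zero {ε R : ℝ} (hεR : ε * R ^ 4 = 1) {x : E4} {i : Fin 4} (hx : |x i| = R) :
    cut ε x = 0 := by
  rw [cut_eq ε i, ← Even.pow_abs (by decide) (x i), hx, hεR]; simp

lemma cut_half {ε R L : ℝ} (hε : 0 < ε) (hεR : ε * R ^ 4 = 1) (hL : 0 < L) (hLR : 2 * L ≤ R)
    {x : E4} (hx : ∀ i, |x i| ≤ L) : 1 / 2 ≤ cut ε x := by
  have h : ∀ j, 15 / 16 ≤ 1 - ε * x j ^ 4 := fun j => by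
    have h2 : |2 * x j| ≤ R := by
      rw [abs_mul, abs_two]; linarith [hx j]
    have := fac_bd hε hεR h2
    nlinarith
  calc (1:ℝ) / 2 ≤ ∏ j : Fin 4, (15 / 16 : ℝ) := by simp; norm_num
    _ ≤ _ := Finset.prod_le_prod (fun _ _ => by norm_num) fun j _ => h j

lemma cut1_abs {ε R : ℝ} (hε : 0 < ε) (hεR : ε * R ^ 4 = 1) {x : E4} (hx : ∀ i, |x i| ≤ R)
    (i : Fin 4) : |cut1 ε i x| ≤ 4 * ε * |x i| ^ 3 := by
  obtain ⟨h0, h1⟩ := cc_bd hε hεR hx i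
  rw [cut1, abs_mul, abs_mul, abs_mul, abs_pow, abs_of_nonneg h0, abs_of_pos hε]
  norm_num
  exact mul_le_of_le_one_right (by positivity) h1

lemma cut2_abs {ε R : ℝ} (hε : 0 < ε) (hεR : ε * R ^ 4 = 1) {x : E4} (hx : ∀ i, |x i| ≤ R)
    (i : Fin 4) : |cut2 ε i x| ≤ 12 * ε * |x i| ^ 2 := by
  obtain ⟨h0, h1⟩ := cc_bd hε hεR hx i
  rw [cut2, abs_mul, abs_mul, abs_mul, abs_pow, abs_of_nonneg h0, abs_of_pos hε]
  norm_num
  exact mul_le_of_le_one_right (by positivity) h1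

lemma cut1_sq {ε R : ℝ} (hε : 0 < ε) (hεR : ε * R ^ 4 = 1) {x : E4} (hx : ∀ i, |x i| ≤ R)
    (i : Fin 4) : cut1 ε i x ^ 2 ≤ 16 * ε * |x i| ^ 2 := by
  have h := pow_le_pow_left₀ (abs_nonneg _) (cut1_abs hε hεR hx i) 2
  rw [sq_abs] at h
  have h2 := fac_bd hε hεR (t := |x i|) (by simpa using hx i)
  calc _ ≤ _ := h
    _ = 16 * ε * |x i| ^ 2 * (ε * |x i| ^ 4) := by ring
    _ ≤ _ := mul_le_of_le_one_right (by positivity) h2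

lemma sq_le_q (x : E4) (i : Fin 4) : |x i| ^ 2 ≤ q x := by
  rw [sq_abs, q]
  have := Finset.single_le_sum (f := fun j => x j ^ 2) (fun j _ => sq_nonneg _) (Finset.mem_univ i)
  linarith

lemma abs_le_q (x : E4) (i : Fin 4) : |x i| ≤ q x := by
  have h : 1 + |x i| ^ 2 ≤ q x := by
    rw [sq_abs, q]
    have := Finset.single_le_sum (f := fun j => x j ^ 2) (fun j _ => sq_nonneg _)
      (Finset.mem_univ i)
    linarith
  nlinarith [sq_nonneg (|x i| - 1), abs_nonneg (x i)]

lemma w3 (x : E4) {a b : ℝ} (ha : 0 ≤ a) (h1 : a ≤ q x) (h2 : b ≤ q x) :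
    w x ^ 2 * (a * b) ≤ 1 := by
  have hq := q_pos x
  have : a * b ≤ q x ^ 2 := by
    calc a * b ≤ a * q x := by gcongr
      _ ≤ q x * q x := by gcongr
      _ = _ := by ring
  calc w x ^ 2 * (a * b) ≤ w x ^ 2 * q x ^ 2 := by gcongr
    _ = (q x * w x) ^ 2 := by ring
    _ = 1 := by rw [qw]; norm_num

lemma ph1_abs (x : E4) (i : Fin 4) : |ph1 i x| ≤ 5 * w x ^ 2 := by
  have hw := w_pos x
  have hd : |de i| ≤ 1 := by unfold de; split_ifs <;> simp
  have hp : |x 0 * x i| ≤ q x := by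
    rw [abs_mul]
    nlinarith [sq_nonneg (|x 0| - |x i|), sq_le_q x 0, sq_le_q x i]
  calc |ph1 i x| ≤ |de i * w x ^ 2| + |4 * (x 0 * x i) * w x ^ 3| := abs_sub _ _
    _ = |de i| * w x ^ 2 + 4 * |x 0 * x i| * w x ^ 3 := by
        rw [abs_mul, abs_mul, abs_mul 4, abs_of_pos (pow_pos hw 2), abs_of_pos (pow_pos hw 3)]
        norm_num
    _ ≤ 1 * w x ^ 2 + 4 * q x * w x ^ 3 := by gcongr
    _ = 5 * w x ^ 2 := by linear_combination 4 * w x ^ 2 * qw x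

lemma err_bd {ε R : ℝ} (hε : 0 < ε) (hεR : ε * R ^ 4 = 1) {x : E4} (hx : ∀ i, |x i| ≤ R)
    (h0 : 0 ≤ x 0) (i : Fin 4) :
    8 * ph1 i x * cut ε x * cut1 ε i x +
      ph x * (12 * cut1 ε i x ^ 2 + 4 * cut ε x * cut2 ε i x) ≤ 400 * ε := by
  obtain ⟨m0, m1⟩ := cut_bd hε hεR hx
  have hw := w_pos x
  have hq := q_pos x
  have A : ph1 i x * cut ε x * cut1 ε i x ≤ 20 * ε := by
    calc _ ≤ |ph1 i x * cut ε x * cut1 ε i x| := le_abs_self _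
      _ = |ph1 i x| * cut ε x * |cut1 ε i x| := by rw [abs_mul, abs_mul, abs_of_nonneg m0]
      _ ≤ (5 * w x ^ 2) * 1 * (4 * ε * |x i| ^ 3) := by
        gcongr
        · exact ph1_abs x i
        · exact cut1_abs hε hεR hx i
      _ = 20 * ε * (w x ^ 2 * (|x i| * |x i| ^ 2)) := by ring
      _ ≤ 20 * ε * 1 := by
        gcongr
        exact w3 x (abs_nonneg _) (abs_le_q x i) (sq_le_q x i)
      _ = _ := by ring
  have hB : 12 * cut1 ε i x ^ 2 + 4 * cut ε x * cut2 ε i x ≤ 240 * ε * |x i| ^ 2 := by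
    have h1 := cut1_sq hε hεR hx i
    have h2 : cut ε x * cut2 ε i x ≤ 12 * ε * |x i| ^ 2 := by
      calc _ ≤ cut ε x * |cut2 ε i x| := by gcongr; exact le_abs_self _
        _ ≤ 1 * (12 * ε * |x i| ^ 2) := by gcongr; exact cut2_abs hε hεR hx i
        _ = _ := one_mul _
    linarith
  have B : ph x * (12 * cut1 ε i x ^ 2 + 4 * cut ε x * cut2 ε i x) ≤ 240 * ε := by
    calc _ ≤ ph x * (240 * ε * |x i| ^ 2) := by
          apply mul_le_mul_of_nonneg_left hB; unfold ph; positivity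
      _ = 240 * ε * (w x ^ 2 * (x 0 * |x i| ^ 2)) := by unfold ph; ring
      _ ≤ 240 * ε * 1 := by
        gcongr
        exact w3 x h0 ((le_abs_self _).trans (abs_le_q x 0)) (sq_le_q x i)
      _ = _ := by ring
  linarith

section core
variable {U : Set E4} {g gd vd vdd : Fin 4 → E4 → ℝ} {v : E4 → ℝ}

lemma step1 (hUo : IsOpen U) (hU : {x : E4 | 0 ≤ x 0} ⊆ U)
    (hg : ∀ i, ContDiffOn ℝ 1 (g i) U) (hv : ContinuousOn v U)
    (hgd : ∀ i, ∀ x : E4, 0 < x 0 → HasLineDerivAt ℝ (g i) (gd i x) x (Pi.single i 1))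
    (hlap : ∀ x : E4, 0 < x 0 → ∑ i, gd i x = - v x)
    (hineq : ∀ x : E4, 0 < x 0 → ∑ i, g i x ^ 2 ≤ v x)
    (hg0 : ∀ x : E4, x 0 = 0 → g 0 x = 0)
    {ε R : ℝ} (hR : 0 < R) (hε : 0 < ε) (hεR : ε * R ^ 4 = 1) :
    ∫ x in box R, v x * cut ε x ^ 2 ≤ 2048 * R ^ 2 := by
  have cm := cd_cut ε
  have cm1 := cd_cut1 ε
  have cmc := cm.continuous
  have cm1c := fun i => (cm1 i).continuous
  have hgc := fun i => (hg i).continuousOn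
  have I := div_zero hR hUo hU (fun i x => g i x * cut ε x ^ 2)
    (fun i x => gd i x * cut ε x ^ 2 + g i x * (2 * cut ε x * cut1 ε i x))
    (fun i => (hg i).mul (cm.pow 2).contDiffOn)
    (fun i x hx => by
      refine ld_eq (ld_mul (hgd i x (box_pos hx)) (ld_pow 2 (ld_cut ε i x))) ?_
      push_cast; ring)
    (fun x hx => by simp [hg0 x hx])
    (fun i x _ hx => by simp [cut_zero hεR hx])
  rw [setIntegral_congr_fun (g := fun x => -(v x * cut ε x ^ 2) +
      ∑ i, g i x * (2 * cut ε x * cut1 ε i x)) (box_open R).measurableSet (fun x hx => by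
    simp only [Finset.sum_add_distrib, ← Finset.sum_mul, hlap x (box_pos hx)]; ring)] at I
  have i1 : IntegrableOn (fun x => v x * cut ε x ^ 2) (box R) :=
    intOn hU (hv.mul (cmc.pow 2).continuousOn)
  have i2 : IntegrableOn (fun x => -(v x * cut ε x ^ 2) +
      ∑ i, g i x * (2 * cut ε x * cut1 ε i x)) (box R) := by
    refine intOn hU (ContinuousOn.add (hv.mul (cmc.pow 2).continuousOn).neg
      (continuousOn_finsetSum _ fun i _ => (hgc i).mul ?_))
    have := cm1c i
    exact (by fun_prop : Continuous fun x => 2 * cut ε x * cut1 ε i x).continuousOn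
  have i3 : IntegrableOn (fun _ : E4 => 256 / R ^ 2) (box R) :=
    intOn (U := univ) (subset_univ _) continuousOn_const
  have hmono := setIntegral_mono_on i1 (i3.sub (i2.const_mul 2)) (box_open R).measurableSet
    (fun x hx => by
      have hxa := box_abs hR hx
      have hs := hineq x (box_pos hx)
      have hcs : ∀ i, cut1 ε i x ^ 2 ≤ 16 / R ^ 2 := fun i => by
        refine (cut1_sq hε hεR hxa i).trans ?_
        rw [le_div_iff₀ (by positivity)]
        have : |x i| ^ 2 ≤ R ^ 2 := by gcongr; exact hxa i
        calc 16 * ε * |x i| ^ 2 * R ^ 2 ≤ 16 * ε * R ^ 2 * R ^ 2 := by gcongr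
          _ = 16 * (ε * R ^ 4) := by ring
          _ = 16 := by rw [hεR]; norm_num
      have hk : ∀ i, -(1/2 * (g i x ^ 2 * cut ε x ^ 2) + 32 / R ^ 2) ≤
          -(g i x * (2 * cut ε x * cut1 ε i x)) := fun i => by
        have : 32 / R ^ 2 = 2 * (16 / R ^ 2) := by ring
        have := hcs i
        nlinarith [sq_nonneg (g i x * cut ε x - 2 * cut1 ε i x)]
      have hsum := Finset.sum_le_sum (s := Finset.univ) fun i _ => hk i
      rw [Finset.sum_neg_distrib, Finset.sum_neg_distrib, Finset.sum_add_distrib,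
        ← Finset.mul_sum, ← Finset.sum_mul] at hsum
      simp only [Finset.sum_const, Finset.card_univ, Fintype.card_fin] at hsum
      have hsm : (∑ i, g i x ^ 2) * cut ε x ^ 2 ≤ v x * cut ε x ^ 2 := by gcongr
      have : 256 / R ^ 2 = 8 * (32 / R ^ 2) := by ring
      simp only [Pi.sub_apply]
      rw [this]
      simp only [nsmul_eq_mul] at hsum
      push_cast at hsum
      linarith)
  refine hmono.trans ?_
  simp only [Pi.sub_apply]
  rw [integral_sub i3 (i2.const_mul 2), integral_const_mul, I]
  simp only [setIntegral_const, box_vol hR, smul_eq_mul]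
  apply le_of_eq
  field_simp
  ring

lemma step2 (hUo : IsOpen U) (hU : {x : E4 | 0 ≤ x 0} ⊆ U)
    (hv : ContDiffOn ℝ 1 v U) (hvd : ∀ i, ContDiffOn ℝ 1 (vd i) U)
    (hv1 : ∀ i, ∀ x : E4, 0 < x 0 → HasLineDerivAt ℝ v (vd i x) x (Pi.single i 1))
    (hv2 : ∀ i, ∀ x : E4, 0 < x 0 → HasLineDerivAt ℝ (vd i) (vdd i x) x (Pi.single i 1))
    (hlap : ∀ x : E4, 0 < x 0 → ∑ i, vdd i x = 0)
    (hvn : ∀ x : E4, 0 < x 0 → 0 ≤ v x)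
    (hv0 : ∀ x : E4, x 0 = 0 → v x = 0)
    {ε R : ℝ} (hR : 0 < R) (hε : 0 < ε) (hεR : ε * R ^ 4 = 1) :
    ∫ x in box R, x 0 * w x ^ 4 * v x * cut ε x ^ 4 ≤
      100 * ε * ∫ x in box R, v x * cut ε x ^ 2 := by
  have cm := cd_cut ε
  have cm1 := cd_cut1 ε
  have cw := cd_w.continuous
  have cmc := cm.continuous
  have cm1c := fun i => (cm1 i).continuous
  have cm2c := fun i => cd_cut2 ε i
  have cp := cd_ph
  have cp1 := cd_ph1
  have cpc := cp.continuous
  have cp1c := fun i => (cp1 i).continuous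
  have cp2c := cd_ph2
  have hvc := hv.continuousOn
  let P1 : Fin 4 → E4 → ℝ := fun i x => ph1 i x * cut ε x ^ 4 + ph x * (4 * cut ε x ^ 3 * cut1 ε i x)
  let P2 : Fin 4 → E4 → ℝ := fun i x => ph2 i x * cut ε x ^ 4 + cut ε x ^ 2 *
    (8 * ph1 i x * cut ε x * cut1 ε i x +
      ph x * (12 * cut1 ε i x ^ 2 + 4 * cut ε x * cut2 ε i x))
  have hP0 : ∀ i x, HasLineDerivAt ℝ (fun x => ph x * cut ε x ^ 4) (P1 i x) x (Pi.single i 1) := by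
    intro i x
    refine ld_eq (ld_mul (ld_ph i x) (ld_pow 4 (ld_cut ε i x))) ?_
    simp only [P1]; push_cast; ring
  have hP1 : ∀ i x, HasLineDerivAt ℝ (P1 i) (P2 i x) x (Pi.single i 1) := by
    intro i x
    refine ld_eq (f := P1 i) (ld_add (ld_mul (ld_ph1 i x) (ld_pow 4 (ld_cut ε i x)))
      (ld_mul (ld_ph i x) (ld_mul (ld_mul (ld_const 4) (ld_pow 3 (ld_cut ε i x)))
        (ld_cut1 ε i x)))) ?_
    simp only [P2]; push_cast; ring
  have cP0 : ContDiff ℝ 1 (fun x => ph x * cut ε x ^ 4) := by fun_prop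
  have cP1 : ∀ i, ContDiff ℝ 1 (P1 i) := fun i => by
    have := cp1 i
    have := cm1 i
    simp only [P1]; fun_prop
  have cP2 : ∀ i, Continuous (P2 i) := fun i => by
    have := cp1c i
    have := cm1c i
    have := cp2c i
    have := cm2c i
    simp only [P2]; fun_prop
  have I := div_zero hR hUo hU (fun i x => v x * P1 i x - ph x * cut ε x ^ 4 * vd i x)
    (fun i x => v x * P2 i x - ph x * cut ε x ^ 4 * vdd i x)
    (fun i => (hv.mul (cP1 i).contDiffOn).sub (cP0.contDiffOn.mul (hvd i)))
    (fun i x hx => by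
      refine ld_eq (ld_sub (ld_mul (hv1 i x (box_pos hx)) (hP1 i x))
        (ld_mul (hP0 i x) (hv2 i x (box_pos hx)))) ?_
      ring)
    (fun x hx => by simp [hv0 x hx, ph, hx])
    (fun i x _ hx => by simp [P1, cut_zero hεR hx])
  rw [setIntegral_congr_fun (g := fun x => v x * ∑ i, P2 i x) (box_open R).measurableSet
    (fun x hx => by
    simp only [Finset.sum_sub_distrib, ← Finset.mul_sum, hlap x (box_pos hx)]; ring)] at I
  have i1 : IntegrableOn (fun x => v x * cut ε x ^ 2) (box R) :=
    intOn hU (hvc.mul (cmc.pow 2).continuousOn)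
  have i2 : IntegrableOn (fun x => v x * ∑ i, P2 i x) (box R) :=
    intOn hU (hvc.mul (continuous_finsetSum _ fun i _ => cP2 i).continuousOn)
  have i3 : IntegrableOn (fun x => x 0 * w x ^ 4 * v x * cut ε x ^ 4) (box R) := by
    refine intOn hU (ContinuousOn.mul (ContinuousOn.mul ?_ hvc) (cmc.pow 4).continuousOn)
    exact (by fun_prop : Continuous fun x : E4 => x 0 * w x ^ 4).continuousOn
  have hmono := setIntegral_mono_on (i3.const_mul 24) ((i1.const_mul (1600 * ε)).sub i2)
    (box_open R).measurableSet
    (fun x hx => by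
      have hx0 := box_pos hx
      have hb := Finset.sum_le_sum (s := Finset.univ) fun i _ =>
        err_bd hε hεR (box_abs hR hx) hx0.le i
      rw [Finset.sum_const, Finset.card_univ, Fintype.card_fin, nsmul_eq_mul] at hb
      push_cast at hb
      simp only [Pi.sub_apply, P2, Finset.sum_add_distrib (f := fun i => ph2 i x * cut ε x ^ 4),
        ← Finset.sum_mul, ← Finset.mul_sum, ph2_sum]
      have := mul_le_mul_of_nonneg_left hb (mul_nonneg (hvn x hx0) (sq_nonneg (cut ε x)))
      linarith)
  simp only [Pi.sub_apply] at hmono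
  rw [integral_sub (i1.const_mul (1600 * ε)) i2, integral_const_mul, integral_const_mul, I] at hmono
  have : 0 ≤ ∫ x in box R, v x * cut ε x ^ 2 :=
    setIntegral_nonneg (box_open R).measurableSet fun x hx =>
      mul_nonneg (hvn x (box_pos hx)) (sq_nonneg _)
  have := mul_nonneg hε.le this
  linarith

lemma core (hUo : IsOpen U) (hU : {x : E4 | 0 ≤ x 0} ⊆ U)
    (hg : ∀ i, ContDiffOn ℝ 1 (g i) U)
    (hgd : ∀ i, ∀ x : E4, 0 < x 0 → HasLineDerivAt ℝ (g i) (gd i x) x (Pi.single i 1))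
    (hlapg : ∀ x : E4, 0 < x 0 → ∑ i, gd i x = - v x)
    (hineq : ∀ x : E4, 0 < x 0 → ∑ i, g i x ^ 2 ≤ v x)
    (hg0 : ∀ x : E4, x 0 = 0 → g 0 x = 0)
    (hv : ContDiffOn ℝ 1 v U) (hvd : ∀ i, ContDiffOn ℝ 1 (vd i) U)
    (hv1 : ∀ i, ∀ x : E4, 0 < x 0 → HasLineDerivAt ℝ v (vd i x) x (Pi.single i 1))
    (hv2 : ∀ i, ∀ x : E4, 0 < x 0 → HasLineDerivAt ℝ (vd i) (vdd i x) x (Pi.single i 1))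
    (hlap : ∀ x : E4, 0 < x 0 → ∑ i, vdd i x = 0)
    (hv0 : ∀ x : E4, x 0 = 0 → v x = 0)
    (x : E4) (hx : 0 < x 0) : v x = 0 := by
  have hvn : ∀ x : E4, 0 < x 0 → 0 ≤ v x := fun x hx =>
    (Finset.sum_nonneg fun i _ => sq_nonneg _).trans (hineq x hx)
  have cw := cd_w.continuous
  obtain ⟨L, hL, hxL⟩ : ∃ L : ℝ, 0 < L ∧ x ∈ box L := by
    refine ⟨‖x‖ + 1, by positivity, fun i _ => ?_⟩
    have h := abs_le.1 (norm_le_pi_norm x i)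
    simp only [lo, hi, mem_Ioo]
    refine ⟨?_, by linarith [h.2]⟩
    split_ifs with h0
    · rw [h0]; exact hx
    · linarith [h.1]
  let f : E4 → ℝ := fun y => y 0 * w y ^ 4 * v y
  have cf : ContinuousOn f U :=
    (by fun_prop : Continuous fun x : E4 => x 0 * w x ^ 4).continuousOn.mul hv.continuousOn
  have fn : ∀ y : E4, 0 < y 0 → 0 ≤ f y := fun y hy => by
    have := hvn y hy
    have := w_pos y
    simp only [f]; positivity
  have fi : ∀ R, IntegrableOn f (box R) := fun R => intOn hU cf
  have bound : ∀ R, 2 * L ≤ R → ∫ y in box L, f y ≤ 3276800 / R ^ 2 := by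
    intro R hLR
    have hR : 0 < R := by linarith
    have hε : 0 < 1 / R ^ 4 := by positivity
    have hεR : 1 / R ^ 4 * R ^ 4 = 1 := by field_simp
    have s1 := step1 hUo hU hg hv.continuousOn hgd hlapg hineq hg0 hR hε hεR
    have s2 := step2 hUo hU hv hvd hv1 hv2 hlap hvn hv0 hR hε hεR
    have cmc := (cd_cut (1 / R ^ 4)).continuous
    have i4 : IntegrableOn (fun y => 16 * (f y * cut (1 / R ^ 4) y ^ 4)) (box R) :=
      intOn hU (continuousOn_const.mul (cf.mul (cmc.pow 4).continuousOn))
    have h1 : ∫ y in box L, f y ≤ ∫ y in box L, 16 * (f y * cut (1 / R ^ 4) y ^ 4) := by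
      refine setIntegral_mono_on (fi L) (i4.mono_set (box_mono (by linarith)))
        (box_open L).measurableSet fun y hy => ?_
      have hm := cut_half hε hεR hL hLR (box_abs hL hy)
      have hm4 : (1 / 2 : ℝ) ^ 4 ≤ cut (1 / R ^ 4) y ^ 4 := by gcongr
      nlinarith [fn y (box_pos hy)]
    have h2 : ∫ y in box L, 16 * (f y * cut (1 / R ^ 4) y ^ 4) ≤
        ∫ y in box R, 16 * (f y * cut (1 / R ^ 4) y ^ 4) := by
      refine setIntegral_mono_set i4 ?_ (box_mono (by linarith)).eventuallyLE
      refine (ae_restrict_iff' (box_open R).measurableSet).2 (Filter.Eventually.of_forall ?_)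
      intro y hy
      have := fn y (box_pos hy)
      have e4 : Even 4 := by decide
      have := e4.pow_nonneg (cut (1 / R ^ 4) y)
      simp only [Pi.zero_apply]
      positivity
    have h3 := h1.trans h2
    rw [integral_const_mul] at h3
    calc _ ≤ _ := h3
      _ ≤ 16 * (100 * (1 / R ^ 4) * (2048 * R ^ 2)) := by
        refine mul_le_mul_of_nonneg_left (s2.trans ?_) (by norm_num)
        exact mul_le_mul_of_nonneg_left s1 (by positivity)
      _ = _ := by field_simp; norm_num
  have hJ0 : 0 ≤ ∫ y in box L, f y :=
    setIntegral_nonneg (box_open L).measurableSet fun y hy => fn y (box_pos hy)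
  have hJ : ∫ y in box L, f y = 0 := by
    refine le_antisymm ?_ hJ0
    refine ge_of_tendsto (Filter.Tendsto.const_div_atTop (Filter.tendsto_pow_atTop
      (α := ℝ) (n := 2) (by norm_num)) 3276800) ?_
    filter_upwards [Filter.eventually_ge_atTop (2 * L)] with R hR using bound R hR
  rw [setIntegral_eq_zero_iff_of_nonneg_ae ?_ (fi L)] at hJ
  · have := Measure.eqOn_open_of_ae_eq hJ (box_open L)
      (cf.mono fun y hy => hU (box_pos hy).le) continuousOn_const hxL
    simp only [f, Pi.zero_apply, mul_eq_zero] at this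
    have hw := (pow_pos (w_pos x) 4).ne'
    rcases this with (h | h) | h
    · exact absurd h hx.ne'
    · exact absurd h hw
    · exact h
  · exact (ae_restrict_iff' (box_open L).measurableSet).2
      (Filter.Eventually.of_forall fun y hy => fn y (box_pos hy))
end core

/-! transfer from the Euclidean space -/

abbrev V4 := EuclideanSpace ℝ (Fin 4)
noncomputable def ee (i : Fin 4) : V4 := EuclideanSpace.single i (1 : ℝ)
noncomputable def LL : E4 ≃L[ℝ] V4 := (EuclideanSpace.equiv (Fin 4) ℝ).symm

lemma LL_apply (x : E4) (i : Fin 4) : (LL x) i = x i := rfl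
lemma LL_single (i : Fin 4) : LL (Pi.single i 1) = ee i := by
  ext j; rw [LL_apply]; simp [ee, Pi.single_apply]

lemma cd_pd {U : Set V4} (hU : IsOpen U) {h : V4 → ℝ} (hh : ContDiffOn ℝ (⊤ : ℕ∞) h U) (a : V4) :
    ContDiffOn ℝ (⊤ : ℕ∞) (fun y => fderiv ℝ h y a) U :=
  (hh.fderiv_of_isOpen hU (by exact_mod_cast le_rfl)).clm_apply contDiffOn_const

lemma lap_eq {U : Set V4} (hU : IsOpen U) {h : V4 → ℝ} (hh : ContDiffOn ℝ (⊤ : ℕ∞) h U)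
    {x : V4} (hx : x ∈ U) :
    lap h x = ∑ i, fderiv ℝ (fun y => fderiv ℝ h y (ee i)) x (ee i) := by
  unfold lap
  refine Finset.sum_congr rfl fun i _ => ?_
  rw [iteratedFDeriv_two_apply]
  have hd : DifferentiableAt ℝ (fderiv ℝ h) x :=
    ((hh.fderiv_of_isOpen (m := 1) hU (by norm_cast)).differentiableOn
      (by norm_num)).differentiableAt (hU.mem_nhds hx)
  rw [fderiv_clm_apply hd (differentiableAt_const _)]
  simp [ee]

lemma cd_lap {U : Set V4} (hU : IsOpen U) {h : V4 → ℝ} (hh : ContDiffOn ℝ (⊤ : ℕ∞) h U) :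
    ContDiffOn ℝ (⊤ : ℕ∞) (lap h) U := by
  have : ContDiffOn ℝ (⊤ : ℕ∞)
      (fun x => ∑ i, fderiv ℝ (fun y => fderiv ℝ h y (ee i)) x (ee i)) U :=
    ContDiffOn.sum fun i _ => cd_pd hU (cd_pd hU hh _) _
  exact this.congr fun x hx => lap_eq hU hh hx

lemma ld_comp {U : Set V4} (hU : IsOpen U) {h : V4 → ℝ} (hh : ContDiffOn ℝ (⊤ : ℕ∞) h U)
    (x : E4) (hx : LL x ∈ U) (i : Fin 4) :
    HasLineDerivAt ℝ (fun y => h (LL y)) (fderiv ℝ h (LL x) (ee i)) x (Pi.single i 1) := by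
  have hd : DifferentiableAt ℝ h (LL x) :=
    (hh.differentiableOn (by simp)).differentiableAt (hU.mem_nhds hx)
  have := (hd.hasFDerivAt.comp x LL.hasFDerivAt).hasLineDerivAt (Pi.single i 1)
  rw [← LL_single]
  exact this

lemma cd_comp {U : Set V4} {h : V4 → ℝ} (hh : ContDiffOn ℝ (⊤ : ℕ∞) h U) :
    ContDiffOn ℝ 1 (fun y => h (LL y)) (LL ⁻¹' U) :=
  (hh.of_le (by norm_cast)).comp LL.contDiff.contDiffOn fun _ hx => hx

lemma grad_coord (u : V4 → ℝ) (x : V4) (i : Fin 4) :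
    fderiv ℝ u x (ee i) = gradient u x i := by
  have : inner ℝ (gradient u x) (ee i) = fderiv ℝ u x (ee i) := by
    unfold gradient
    exact InnerProductSpace.toDual_symm_apply
  rw [← this, ee, EuclideanSpace.inner_single_right]
  simp

lemma grad_norm (u : V4 → ℝ) (x : V4) :
    ‖gradient u x‖ ^ 2 = ∑ i, fderiv ℝ u x (ee i) ^ 2 := by
  rw [EuclideanSpace.norm_sq_eq]
  refine Finset.sum_congr rfl fun i _ => ?_
  rw [grad_coord, Real.norm_eq_abs, sq_abs]

end NB

/-- **Liouville-type theorem on the half-space (Proposition 4.6, analytic core).**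
If `u` is smooth on a neighborhood of the closed half-space `{x₁ ≥ 0}` in `ℝ⁴`,
biharmonic on `{x₁ > 0}`, satisfies `−Δu − |∇u|² ≥ 0` and `x₁·Δu = 2∂₁u` there, and
`u = 0`, `∇u = 0`, `Δu = 0` on the boundary `{x₁ = 0}`, then `u ≡ 0` on `{x₁ ≥ 0}`. -/
theorem no_boundary_blowup_liouville (u : EuclideanSpace ℝ (Fin 4) → ℝ)
    (hsmooth : ∃ U : Set (EuclideanSpace ℝ (Fin 4)), IsOpen U ∧
      {x : EuclideanSpace ℝ (Fin 4) | 0 ≤ x 0} ⊆ U ∧ ContDiffOn ℝ (⊤ : ℕ∞) u U)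
    (hbiharm : ∀ x : EuclideanSpace ℝ (Fin 4), 0 < x 0 → lap (lap u) x = 0)
    (hscal : ∀ x : EuclideanSpace ℝ (Fin 4), 0 < x 0 →
      0 ≤ - lap u x - ‖gradient u x‖ ^ 2)
    (hconf : ∀ x : EuclideanSpace ℝ (Fin 4), 0 < x 0 →
      x 0 * lap u x = 2 * fderiv ℝ u x (EuclideanSpace.single 0 (1 : ℝ)))
    (hbdry : ∀ x : EuclideanSpace ℝ (Fin 4), x 0 = 0 →
      u x = 0 ∧ gradient u x = 0 ∧ lap u x = 0) :
    ∀ x : EuclideanSpace ℝ (Fin 4), 0 ≤ x 0 → u x = 0 := by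
  obtain ⟨U, hUo, hU, hu⟩ := hsmooth
  have hl := NB.cd_lap hUo hu
  have hpos : ∀ x : NB.E4, 0 < x 0 → NB.LL x ∈ U := fun x hx => hU (le_of_lt hx)
  have hl' : ContDiffOn ℝ (⊤ : ℕ∞) (fun y => - lap u y) U := hl.neg
  have hv0 : ∀ x : NB.E4, 0 < x 0 → - lap u (NB.LL x) = 0 := by
    refine NB.core (U := NB.LL ⁻¹' U) (g := fun i x => fderiv ℝ u (NB.LL x) (NB.ee i))
      (v := fun x => - lap u (NB.LL x))
      (gd := fun i x => fderiv ℝ (fun y => fderiv ℝ u y (NB.ee i)) (NB.LL x) (NB.ee i))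
      (vd := fun i x => fderiv ℝ (fun y => - lap u y) (NB.LL x) (NB.ee i))
      (vdd := fun i x => fderiv ℝ (fun y => fderiv ℝ (fun y => - lap u y) y (NB.ee i))
        (NB.LL x) (NB.ee i))
      (hUo.preimage NB.LL.continuous) (fun x hx => hU hx)
      (fun i => NB.cd_comp (NB.cd_pd hUo hu _))
      (fun i x hx => NB.ld_comp hUo (NB.cd_pd hUo hu _) x (hpos x hx) i)
      (fun x hx => by rw [NB.lap_eq hUo hu (hpos x hx), neg_neg])
      (fun x hx => by
        rw [← NB.grad_norm]
        linarith [hscal (NB.LL x) hx])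
      (fun x hx => by
        simp only [NB.grad_coord, (hbdry (NB.LL x) hx).2.1]
        rfl)
      (NB.cd_comp hl')
      (fun i => NB.cd_comp (NB.cd_pd hUo hl' _))
      (fun i x hx => NB.ld_comp hUo hl' x (hpos x hx) i)
      (fun i x hx => NB.ld_comp hUo (NB.cd_pd hUo hl' _) x (hpos x hx) i)
      (fun x hx => by
        have h1 := hbiharm (NB.LL x) hx
        rw [NB.lap_eq hUo hl (hpos x hx)] at h1
        have h2 : ∀ i, (fun y => fderiv ℝ (fun y => - lap u y) y (NB.ee i)) =
            fun y => - fderiv ℝ (lap u) y (NB.ee i) := fun i => by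
          funext y; rw [fderiv_fun_neg]; rfl
        have h3 : ∀ i, fderiv ℝ (fun y => fderiv ℝ (fun y => - lap u y) y (NB.ee i))
            (NB.LL x) (NB.ee i) =
            - fderiv ℝ (fun y => fderiv ℝ (lap u) y (NB.ee i)) (NB.LL x) (NB.ee i) := fun i => by
          rw [h2 i, fderiv_fun_neg]; rfl
        rw [Finset.sum_congr rfl fun i _ => h3 i, Finset.sum_neg_distrib, h1, neg_zero])
      (fun x hx => by simp only [(hbdry (NB.LL x) hx).2.2, neg_zero])
  have hgrad : ∀ x : EuclideanSpace ℝ (Fin 4), 0 ≤ x 0 → gradient u x = 0 := by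
    intro x hx
    rcases hx.eq_or_lt with h | h
    · exact (hbdry x h.symm).2.1
    · have h1 := hscal x h
      have h2 : - lap u x = 0 := by simpa using hv0 (NB.LL.symm x) h
      rw [h2] at h1
      have : ‖gradient u x‖ ^ 2 = 0 := le_antisymm (by linarith) (sq_nonneg _)
      simpa using this
  have hfd : ∀ x : EuclideanSpace ℝ (Fin 4), 0 ≤ x 0 → HasFDerivAt u (0 : _ →L[ℝ] ℝ) x := by
    intro x hx
    have hd : DifferentiableAt ℝ u x :=
      (hu.differentiableOn (by simp)).differentiableAt (hUo.mem_nhds (hU hx))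
    have := hgrad x hx
    unfold gradient at this
    rw [map_eq_zero_iff _ (LinearIsometryEquiv.injective _)] at this
    rw [← this]
    exact hd.hasFDerivAt
  intro x hx
  have hconv : Convex ℝ {x : EuclideanSpace ℝ (Fin 4) | 0 ≤ x 0} := by
    intro a ha b hb s t hs ht _
    simp only [Set.mem_setOf_eq, PiLp.add_apply, PiLp.smul_apply, smul_eq_mul] at *
    positivity
  have := hconv.norm_image_sub_le_of_norm_hasFDerivWithin_le (f := u) (C := 0)
    (fun y hy => (hfd y hy).hasFDerivWithinAt) (fun y _ => by simp)
    (show (0 : EuclideanSpace ℝ (Fin 4)) ∈ {x : EuclideanSpace ℝ (Fin 4) | 0 ≤ x 0} by simp) hx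
  rw [(hbdry 0 (by simp)).1] at this
  simpa using this
end

section
/- Let H = {x ∈ ℝ⁴ : x₁ > 0} be the open upper half-space. Suppose h : ℝ⁴ → ℝ is continuous on the closed half-space H̄ = {x ∈ ℝ⁴ : x₁ ≥ 0}, harmonic on H (i.e. Δh = 0 on H), non-negative on H, and vanishes at every boundary point x with x₁ = 0. Then there exists a constant a ≥ 0 such that h(x) = a·x₁ for all x ∈ H̄. (This is the Boas–Boas representation of non-negative harmonic functions on a half-space vanishing on the boundary, which the paper applies to −Δu in its Liouville argument ruling out boundary blow-up.) -/
namespace BB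
open MeasureTheory Set Filter Topology

local notation "E4" => EuclideanSpace ℝ (Fin 4)

/-- coordinate vectors -/
noncomputable def ev (i : Fin 4) : EuclideanSpace ℝ (Fin 4) := EuclideanSpace.single i (1 : ℝ)

lemma cont_coord (i : Fin 4) : Continuous (fun x : E4 => x i) := by fun_prop

lemma integrable_mul (f T : E4 → ℝ) (δ L : ℝ) (hδ : 0 < δ)
    (hf : ContinuousOn f {x : E4 | 0 < x 0}) (hT : Continuous T)
    (h0 : ∀ x : E4, x 0 < δ → T x = 0) (hL : ∀ x : E4, L < ‖x‖ → T x = 0) :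
    Integrable (fun x => f x * T x) := by
  set K : Set E4 := {x : E4 | δ ≤ x 0} ∩ Metric.closedBall 0 L with hK
  have hKc : IsCompact K :=
    (isCompact_closedBall (0 : E4) L).inter_left (isClosed_le continuous_const (cont_coord 0))
  have h1 : IntegrableOn (fun x => f x * T x) K := by
    apply ContinuousOn.integrableOn_compact hKc
    apply ContinuousOn.mul _ hT.continuousOn
    exact hf.mono (fun x hx => lt_of_lt_of_le hδ hx.1)
  rwa [integrableOn_iff_integrable_of_support_subset] at h1
  intro x hx
  have hTx : T x ≠ 0 := fun h => hx (by simp [h])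
  refine ⟨?_, ?_⟩
  · by_contra h
    exact hTx (h0 x (not_le.1 h))
  · by_contra h
    exact hTx (hL x (by simpa using h))

lemma tsupport_sub (T : E4 → ℝ) (δ : ℝ) (h0 : ∀ x : E4, x 0 < δ → T x = 0) :
    tsupport T ⊆ {x : E4 | δ ≤ x 0} := by
  apply closure_minimal _ (isClosed_le continuous_const (cont_coord 0))
  intro x hx
  by_contra h
  exact hx (h0 x (not_le.1 h))

lemma green (g : E4 → ℝ) (hd : ∀ x : E4, 0 < x 0 → ContDiffAt ℝ 2 g x)
    (hl : ∀ x : E4, 0 < x 0 → lap g x = 0)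
    (T : E4 → ℝ) (T1 T2 : Fin 4 → E4 → ℝ) (δ L : ℝ) (hδ : 0 < δ)
    (hT : Continuous T) (hT1 : ∀ i, Continuous (T1 i)) (hT2 : ∀ i, Continuous (T2 i))
    (hd1 : ∀ i x, HasLineDerivAt ℝ T (T1 i x) x (ev i))
    (hd2 : ∀ i x, HasLineDerivAt ℝ (T1 i) (T2 i x) x (ev i))
    (h0 : ∀ x : E4, x 0 < δ → T x = 0) (h01 : ∀ i, ∀ x : E4, x 0 < δ → T1 i x = 0)
    (h02 : ∀ i, ∀ x : E4, x 0 < δ → T2 i x = 0)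
    (hL0 : ∀ x : E4, L < ‖x‖ → T x = 0) (hL1 : ∀ i, ∀ x : E4, L < ‖x‖ → T1 i x = 0)
    (hL2 : ∀ i, ∀ x : E4, L < ‖x‖ → T2 i x = 0) :
    ∫ x, g x * ∑ i, T2 i x = 0 := by
  set U : Set E4 := {x : E4 | 0 < x 0} with hU
  have hUo : IsOpen U := isOpen_lt continuous_const (cont_coord 0)
  have hgU : ContDiffOn ℝ 2 g U := fun x hx => (hd x hx).contDiffWithinAt
  have hfd : ContDiffOn ℝ 1 (fderiv ℝ g) U := by
    apply hgU.fderiv_of_isOpen hUo; norm_num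
  have hfdd : ContDiffOn ℝ 0 (fderiv ℝ (fderiv ℝ g)) U := by
    apply hfd.fderiv_of_isOpen hUo; norm_num
  set g1 : Fin 4 → E4 → ℝ := fun i x => fderiv ℝ g x (ev i) with hg1
  set g2 : Fin 4 → E4 → ℝ := fun i x => fderiv ℝ (fderiv ℝ g) x (ev i) (ev i) with hg2
  have c1 : ∀ i, ContinuousOn (g1 i) U := fun i => hfd.continuousOn.clm_apply continuousOn_const
  have c2 : ∀ i, ContinuousOn (g2 i) U := fun i =>
    (hfdd.continuousOn.clm_apply continuousOn_const).clm_apply continuousOn_const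
  have d1 : ∀ i, ∀ x ∈ U, HasLineDerivAt ℝ g (g1 i x) x (ev i) := fun i x hx =>
    ((hd x hx).differentiableAt (by norm_num)).hasFDerivAt.hasLineDerivAt _
  have d2 : ∀ i, ∀ x ∈ U, HasLineDerivAt ℝ (g1 i) (g2 i x) x (ev i) := by
    intro i x hx
    have := ((hfd.differentiableOn (by norm_num)).differentiableAt (hUo.mem_nhds hx)).hasFDerivAt
    have h2 := (this.clm_apply (hasFDerivAt_const (ev i) x)).hasLineDerivAt (ev i)
    simpa [hg1, hg2] using h2
  have hlap : ∀ x ∈ U, ∑ i, g2 i x = 0 := by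
    intro x hx
    rw [← hl x hx, lap]
    apply Finset.sum_congr rfl
    intro i _
    rw [iteratedFDeriv_two_apply]
    simp [hg2, ev]
  have key : ∀ i, ∫ x, g x * T2 i x = ∫ x, g2 i x * T x := by
    intro i
    have e1 := integral_bilinear_hasLineDerivAt_right_eq_neg_left_of_integrable
      (μ := (volume : Measure E4)) (f := g) (f' := g1 i) (g := T1 i) (g' := T2 i) (v := ev i)
      (B := ContinuousLinearMap.mul ℝ ℝ)
      (integrable_mul _ _ δ L hδ (c1 i) (hT1 i) (h01 i) (hL1 i))
      (integrable_mul _ _ δ L hδ hgU.continuousOn (hT2 i) (h02 i) (hL2 i))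
      (integrable_mul _ _ δ L hδ hgU.continuousOn (hT1 i) (h01 i) (hL1 i))
      (fun x hx => d1 i x (lt_of_lt_of_le hδ (tsupport_sub _ δ (h01 i) hx)))
      (fun x _ => hd2 i x)
    have e2 := integral_bilinear_hasLineDerivAt_right_eq_neg_left_of_integrable
      (μ := (volume : Measure E4)) (f := g1 i) (f' := g2 i) (g := T) (g' := T1 i) (v := ev i)
      (B := ContinuousLinearMap.mul ℝ ℝ)
      (integrable_mul _ _ δ L hδ (c2 i) hT h0 hL0)
      (integrable_mul _ _ δ L hδ (c1 i) (hT1 i) (h01 i) (hL1 i))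
      (integrable_mul _ _ δ L hδ (c1 i) hT h0 hL0)
      (fun x hx => d2 i x (lt_of_lt_of_le hδ (tsupport_sub _ δ h0 hx)))
      (fun x _ => hd1 i x)
    simp only [ContinuousLinearMap.mul_apply'] at e1 e2
    rw [e1, e2, neg_neg]
  calc ∫ x, g x * ∑ i, T2 i x = ∫ x, ∑ i, g x * T2 i x := by
        simp_rw [Finset.mul_sum]
    _ = ∑ i, ∫ x, g x * T2 i x := integral_finsetSum _ (fun i _ =>
        integrable_mul _ _ δ L hδ hgU.continuousOn (hT2 i) (h02 i) (hL2 i))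
    _ = ∑ i, ∫ x, g2 i x * T x := Finset.sum_congr rfl (fun i _ => key i)
    _ = ∫ x, ∑ i, g2 i x * T x := (integral_finsetSum _ (fun i _ =>
        integrable_mul _ _ δ L hδ (c2 i) hT h0 hL0)).symm
    _ = ∫ x, (0 : ℝ) := by
        congr 1; ext x
        rw [← Finset.sum_mul]
        by_cases hx : x ∈ U
        · rw [hlap x hx, zero_mul]
        · rw [h0 x (lt_of_le_of_lt (not_lt.1 hx) hδ), mul_zero]
    _ = 0 := by simp

lemma exists_cutoff : ∃ (S S1 S2 : ℝ → ℝ) (M : ℝ), 0 ≤ M ∧ Continuous S ∧ Continuous S1 ∧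
    Continuous S2 ∧ (∀ t, HasDerivAt S (S1 t) t) ∧ (∀ t, HasDerivAt S1 (S2 t) t) ∧
    (∀ t, t < 0 → S t = 0 ∧ S1 t = 0 ∧ S2 t = 0) ∧ (∀ t, 1 < t → S t = 1 ∧ S1 t = 0 ∧ S2 t = 0) ∧
    (∀ t, |S t| ≤ M ∧ |S1 t| ≤ M ∧ |S2 t| ≤ M) := by
  have hc : ContDiff ℝ 2 Real.smoothTransition := Real.smoothTransition.contDiff (n := 2)
  have hc1 : ContDiff ℝ 1 (deriv Real.smoothTransition) := by
    have : ContDiff ℝ (1 + 1) Real.smoothTransition := by simpa [one_add_one_eq_two] using hc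
    exact (contDiff_succ_iff_deriv.1 this).2.2
  have hc2 : Continuous (deriv (deriv Real.smoothTransition)) := hc1.continuous_deriv (by norm_num)
  have l0 : ∀ t < 0, deriv Real.smoothTransition t = 0 := by
    intro t ht
    have : Real.smoothTransition =ᶠ[𝓝 t] fun _ => 0 := by
      filter_upwards [gt_mem_nhds ht] with y hy
      exact Real.smoothTransition.zero_of_nonpos hy.le
    rw [this.deriv_eq]; simp
  have l1 : ∀ t, 1 < t → deriv Real.smoothTransition t = 0 := by
    intro t ht
    have : Real.smoothTransition =ᶠ[𝓝 t] fun _ => 1 := by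
      filter_upwards [lt_mem_nhds ht] with y hy
      exact Real.smoothTransition.one_of_one_le hy.le
    rw [this.deriv_eq]; simp
  have m0 : ∀ t < 0, deriv (deriv Real.smoothTransition) t = 0 := by
    intro t ht
    have : deriv Real.smoothTransition =ᶠ[𝓝 t] fun _ => 0 := by
      filter_upwards [gt_mem_nhds ht] with y hy
      exact l0 y hy
    rw [this.deriv_eq]; simp
  have m1 : ∀ t, 1 < t → deriv (deriv Real.smoothTransition) t = 0 := by
    intro t ht
    have : deriv Real.smoothTransition =ᶠ[𝓝 t] fun _ => 0 := by
      filter_upwards [lt_mem_nhds ht] with y hy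
      exact l1 y hy
    rw [this.deriv_eq]; simp
  obtain ⟨A, hA⟩ := (isCompact_Icc (a := (0 : ℝ)) (b := 1)).exists_bound_of_continuousOn
    hc1.continuous.continuousOn
  obtain ⟨B, hB⟩ := (isCompact_Icc (a := (0 : ℝ)) (b := 1)).exists_bound_of_continuousOn
    hc2.continuousOn
  refine ⟨Real.smoothTransition, deriv Real.smoothTransition, deriv (deriv Real.smoothTransition),
    max 1 (max A B), by positivity, hc.continuous, hc1.continuous, hc2,
    fun t => (hc.differentiable (by norm_num) t).hasDerivAt,
    fun t => (hc1.differentiable (by norm_num) t).hasDerivAt,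
    fun t ht => ⟨Real.smoothTransition.zero_of_nonpos ht.le, l0 t ht, m0 t ht⟩,
    fun t ht => ⟨Real.smoothTransition.one_of_one_le ht.le, l1 t ht, m1 t ht⟩, ?_⟩
  intro t
  have hM : 0 ≤ max 1 (max A B) := by positivity
  refine ⟨?_, ?_, ?_⟩
  · rw [abs_of_nonneg (Real.smoothTransition.nonneg t)]
    exact (Real.smoothTransition.le_one t).trans (le_max_left _ _)
  · rcases lt_or_ge t 0 with h | h
    · rw [l0 t h, abs_zero]; exact hM
    rcases lt_or_ge 1 t with h' | h'
    · rw [l1 t h', abs_zero]; exact hM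
    exact (hA t ⟨h, h'⟩).trans ((le_max_left _ _).trans (le_max_right _ _))
  · rcases lt_or_ge t 0 with h | h
    · rw [m0 t h, abs_zero]; exact hM
    rcases lt_or_ge 1 t with h' | h'
    · rw [m1 t h', abs_zero]; exact hM
    exact (hB t ⟨h, h'⟩).trans ((le_max_right _ _).trans (le_max_right _ _))

/-- flat box -/
def box (δ L : ℝ) : Set (EuclideanSpace ℝ (Fin 4)) :=
  WithLp.ofLp ⁻¹' (Set.Icc (![0, -L, -L, -L] : Fin 4 → ℝ) ![δ, L, L, L])

lemma box_vol (δ L : ℝ) (hδ : 0 ≤ δ) (hL : 0 ≤ L) :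
    (volume (box δ L)) = ENNReal.ofReal (δ * (2 * L) ^ 3) := by
  rw [box, (PiLp.volume_preserving_ofLp (Fin 4)).measure_preimage
    measurableSet_Icc.nullMeasurableSet, Real.volume_Icc_pi]
  simp only [Fin.prod_univ_four]
  change ENNReal.ofReal (δ - 0) * ENNReal.ofReal (L - -L) * ENNReal.ofReal (L - -L) *
    ENNReal.ofReal (L - -L) = _
  have : L - -L = 2 * L := by ring
  rw [this, sub_zero]
  rw [← ENNReal.ofReal_mul (by positivity), ← ENNReal.ofReal_mul (by positivity),
    ← ENNReal.ofReal_mul (by positivity)]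
  congr 1; ring

lemma abs_coord_le (x : E4) (i : Fin 4) : |x i| ≤ ‖x‖ := by
  simpa using PiLp.norm_apply_le x i

lemma mem_box (δ L : ℝ) (x : E4) (h0 : 0 ≤ x 0) (h1 : x 0 ≤ δ) (hx : ‖x‖ ≤ L) : x ∈ box δ L := by
  have h := fun i => abs_le.1 ((abs_coord_le x i).trans hx)
  constructor <;> intro i <;> fin_cases i <;> simp
  · exact h0
  · exact (h 1).1
  · exact (h 2).1
  · exact (h 3).1
  · exact h1
  · exact (h 1).2
  · exact (h 2).2
  · exact (h 3).2

lemma small_near (g : E4 → ℝ) (hg : Continuous g) (hg0 : ∀ x : E4, x 0 ≤ 0 → g x = 0) (L ε : ℝ)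
    (hε : 0 < ε) : ∃ δ, 0 < δ ∧ ∀ x : E4, 0 ≤ x 0 → x 0 ≤ δ → ‖x‖ ≤ L → |g x| ≤ ε := by
  have hu := (isCompact_closedBall (0 : E4) L).uniformContinuousOn_of_continuous hg.continuousOn
  obtain ⟨d, hd, h⟩ := Metric.uniformContinuousOn_iff.1 hu ε hε
  refine ⟨d / 2, by positivity, fun x h0 h1 hx => ?_⟩
  set y : E4 := x - (x 0) • ev 0 with hy
  have hy0 : y 0 = 0 := by simp [hy, ev]
  have hyn : ‖y‖ ≤ ‖x‖ := by
    rw [EuclideanSpace.norm_eq, EuclideanSpace.norm_eq]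
    apply Real.sqrt_le_sqrt
    simp [Fin.sum_univ_four, hy, ev]
    positivity
  have := h x (by simpa using hx) y (by simpa using hyn.trans hx) (by
    rw [dist_eq_norm, hy]
    simp [norm_smul, ev, abs_of_nonneg h0]
    linarith)
  rw [hg0 y hy0.le, Real.dist_eq, sub_zero] at this
  exact this.le

lemma line_cut (S S1 : ℝ → ℝ) (hS : ∀ t, HasDerivAt S (S1 t) t) (δ : ℝ) (i : Fin 4) (x : E4) :
    HasLineDerivAt ℝ (fun x : E4 => S (x 0 / δ - 1)) (if i = 0 then S1 (x 0 / δ - 1) / δ else 0)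
      x (ev i) := by
  unfold HasLineDerivAt
  split_ifs with h
  · subst h
    have h1 : HasDerivAt (fun t : ℝ => (x + t • ev 0) 0 / δ - 1) (1 / δ) 0 := by
      have : (fun t : ℝ => (x + t • ev 0) 0 / δ - 1) = fun t : ℝ => (x 0 + t) / δ - 1 := by
        ext t; simp [ev]
      rw [this]
      exact (((hasDerivAt_id (0 : ℝ)).const_add (x 0)).div_const δ).sub_const 1
    have h2 : HasDerivAt S (S1 (x 0 / δ - 1)) ((fun t : ℝ => (x + t • ev 0) 0 / δ - 1) 0) := by
      simpa using hS (x 0 / δ - 1)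
    have := h2.comp (0 : ℝ) h1
    simpa [Function.comp_def, div_eq_mul_inv] using this
  · have : (fun t : ℝ => S ((x + t • ev i) 0 / δ - 1)) = fun _ => S (x 0 / δ - 1) := by
      ext t; simp [ev, Ne.symm h]
    rw [this]
    exact hasDerivAt_const _ _

lemma line_mul {f g : E4 → ℝ} {f' g' : ℝ} {x v : E4} (hf : HasLineDerivAt ℝ f f' x v)
    (hg : HasLineDerivAt ℝ g g' x v) :
    HasLineDerivAt ℝ (fun y => f y * g y) (f' * g x + f x * g') x v := by
  unfold HasLineDerivAt at *
  have := hf.fun_mul hg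
  simpa using this

lemma line_add {f g : E4 → ℝ} {f' g' : ℝ} {x v : E4} (hf : HasLineDerivAt ℝ f f' x v)
    (hg : HasLineDerivAt ℝ g g' x v) :
    HasLineDerivAt ℝ (fun y => f y + g y) (f' + g') x v := by
  unfold HasLineDerivAt at *
  exact hf.add hg

lemma line_sub {f g : E4 → ℝ} {f' g' : ℝ} {x v : E4} (hf : HasLineDerivAt ℝ f f' x v)
    (hg : HasLineDerivAt ℝ g g' x v) :
    HasLineDerivAt ℝ (fun y => f y - g y) (f' - g') x v := by
  unfold HasLineDerivAt at *
  exact hf.sub hg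

lemma integrable_cs (f : E4 → ℝ) (hf : Continuous f) (L : ℝ) (h : ∀ x : E4, L < ‖x‖ → f x = 0) :
    Integrable f := by
  apply hf.integrable_of_hasCompactSupport
  apply HasCompactSupport.intro (isCompact_closedBall (0 : E4) L)
  intro x hx
  exact h x (by simpa using hx)

lemma green_bdry (g : E4 → ℝ) (hg : Continuous g) (hg0 : ∀ x : E4, x 0 ≤ 0 → g x = 0)
    (hd : ∀ x : E4, 0 < x 0 → ContDiffAt ℝ 2 g x)
    (hl : ∀ x : E4, 0 < x 0 → lap g x = 0)
    (T : E4 → ℝ) (T1 T2 : Fin 4 → E4 → ℝ) (L C : ℝ) (hL : 0 ≤ L) (hC : 0 ≤ C)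
    (hT : Continuous T) (hT1 : ∀ i, Continuous (T1 i)) (hT2 : ∀ i, Continuous (T2 i))
    (hd1 : ∀ i x, HasLineDerivAt ℝ T (T1 i x) x (ev i))
    (hd2 : ∀ i x, HasLineDerivAt ℝ (T1 i) (T2 i x) x (ev i))
    (hL0 : ∀ x : E4, L < ‖x‖ → T x = 0) (hL1 : ∀ i, ∀ x : E4, L < ‖x‖ → T1 i x = 0)
    (hL2 : ∀ i, ∀ x : E4, L < ‖x‖ → T2 i x = 0)
    (hC0 : ∀ x : E4, |T x| ≤ C * |x 0|) (hC1 : ∀ x : E4, |T1 0 x| ≤ C)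
    (hC2 : ∀ x : E4, |∑ i, T2 i x| ≤ C) :
    ∫ x, g x * ∑ i, T2 i x = 0 := by
  obtain ⟨S, S1, S2, M, hM, cS, cS1, cS2, dS, dS1, z0, z1, bd⟩ := exists_cutoff
  have main : ∀ ε > 0, |∫ x, g x * ∑ i, T2 i x| ≤ ε * (C * (1 + 5 * M) * (2 * (2 * L) ^ 3)) := by
    intro ε hε
    obtain ⟨d, hd0, hsm⟩ := small_near g hg hg0 L ε hε
    set δ := min (d / 2) 1 with hδd
    have hδ : 0 < δ := by positivity
    have hδ1 : δ ≤ 1 := min_le_right _ _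
    have hδ2 : 2 * δ ≤ d := by have := min_le_left (d / 2) 1; linarith
    set η : E4 → ℝ := fun x => S (x 0 / δ - 1)
    set η1 : E4 → ℝ := fun x => S1 (x 0 / δ - 1) / δ
    set η2 : E4 → ℝ := fun x => S2 (x 0 / δ - 1) / δ / δ
    have cη : Continuous η := by fun_prop
    have cη1 : Continuous η1 := by fun_prop
    have cη2 : Continuous η2 := by fun_prop
    have dη : ∀ i x, HasLineDerivAt ℝ η (if i = 0 then η1 x else 0) x (ev i) :=
      fun i x => line_cut S S1 dS δ i x
    have dη1 : ∀ i x, HasLineDerivAt ℝ η1 (if i = 0 then η2 x else 0) x (ev i) := by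
      intro i x
      have := line_cut (fun t => S1 t / δ) (fun t => S2 t / δ) (fun t => (dS1 t).div_const δ) δ i x
      exact this
    have hlow : ∀ x : E4, x 0 < δ → η x = 0 ∧ η1 x = 0 ∧ η2 x = 0 := by
      intro x hx
      have := z0 (x 0 / δ - 1) (by rw [sub_neg, div_lt_one hδ]; exact hx)
      simp [η, η1, η2, this]
    have hhigh : ∀ x : E4, 2 * δ < x 0 → η x = 1 ∧ η1 x = 0 ∧ η2 x = 0 := by
      intro x hx
      have := z1 (x 0 / δ - 1) (by rw [lt_sub_iff_add_lt, lt_div_iff₀ hδ]; linarith)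
      simp [η, η1, η2, this]
    set V : E4 → ℝ := fun x => T x * η x
    set V1 : Fin 4 → E4 → ℝ := fun i x => T1 i x * η x + T x * (if i = 0 then η1 x else 0)
    set V2 : Fin 4 → E4 → ℝ := fun i x => (T2 i x * η x + T1 i x * (if i = 0 then η1 x else 0)) +
      (T1 i x * (if i = 0 then η1 x else 0) + T x * (if i = 0 then η2 x else 0))
    have cif : ∀ (f : E4 → ℝ), Continuous f → ∀ i : Fin 4,
        Continuous (fun x => if i = 0 then f x else 0) := by
      intro f hf i
      split_ifs
      · exact hf
      · exact continuous_const
    have cV2 : ∀ i, Continuous (V2 i) := fun i =>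
      (((hT2 i).mul cη).add ((hT1 i).mul (cif _ cη1 i))).add
        (((hT1 i).mul (cif _ cη1 i)).add (hT.mul (cif _ cη2 i)))
    have hV2L : ∀ i, ∀ x : E4, L < ‖x‖ → V2 i x = 0 := fun i x hx => by
      simp [V2, hL0 x hx, hL1 i x hx, hL2 i x hx]
    have G := green g hd hl V V1 V2 δ L hδ (hT.mul cη)
      (fun i => ((hT1 i).mul cη).add (hT.mul (cif _ cη1 i))) cV2
      (fun i x => line_mul (hd1 i x) (dη i x))
      (fun i x => by
        refine line_add (line_mul (hd2 i x) (dη i x)) (line_mul (hd1 i x) ?_)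
        by_cases hi : i = 0
        · simpa [hi] using dη1 0 x
        · simp only [hi, if_false]
          exact hasDerivAt_const _ _)
      (fun x hx => by simp [V, hlow x hx])
      (fun i x hx => by simp [V1, hlow x hx])
      (fun i x hx => by simp [V2, hlow x hx])
      (fun x hx => by simp [V, hL0 x hx])
      (fun i x hx => by simp [V1, hL0 x hx, hL1 i x hx])
      hV2L
    have I1 : Integrable (fun x => g x * ∑ i, T2 i x) :=
      integrable_cs _ (hg.mul (continuous_finsetSum _ fun i _ => hT2 i)) L
        (fun x hx => by simp [hL2 _ x hx])
    have I2 : Integrable (fun x => g x * ∑ i, V2 i x) :=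
      integrable_cs _ (hg.mul (continuous_finsetSum _ fun i _ => cV2 i)) L
        (fun x hx => by simp [hV2L _ x hx])
    have hsum : ∀ x, ∑ i, V2 i x = (∑ i, T2 i x) * η x + (2 * T1 0 x * η1 x + T x * η2 x) := by
      intro x
      simp [V2, Fin.sum_univ_four]
      ring
    set D : E4 → ℝ := fun x => g x * ∑ i, T2 i x - g x * ∑ i, V2 i x with hD
    have hDint : ∫ x, g x * ∑ i, T2 i x = ∫ x, D x := by
      rw [hD, integral_sub I1 I2, G, sub_zero]
    have hD0 : ∀ x, x ∉ box (2 * δ) L → D x = 0 := by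
      intro x hx
      rcases le_or_gt (x 0) 0 with h | h
      · simp [hD, hg0 x h]
      rcases lt_or_ge (2 * δ) (x 0) with h2 | h2
      · simp only [hD, hsum, hhigh x h2]; ring
      rcases lt_or_ge L ‖x‖ with h3 | h3
      · simp [hD, hL2 _ x h3, hV2L _ x h3]
      exact absurd (mem_box _ _ x h.le h2 h3) hx
    have hDb : ∀ x ∈ box (2 * δ) L, ‖D x‖ ≤ ε * (C * (1 + 5 * M) / δ) := by
      intro x _
      have hnn : 0 ≤ ε * (C * (1 + 5 * M) / δ) := by positivity
      rcases le_or_gt (x 0) 0 with h | h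
      · simpa [hD, hg0 x h] using hnn
      rcases lt_or_ge (2 * δ) (x 0) with h2 | h2
      · have : D x = 0 := by simp only [hD, hsum, hhigh x h2]; ring
        simpa [this] using hnn
      rcases lt_or_ge L ‖x‖ with h3 | h3
      · simpa [hD, hL2 _ x h3, hV2L _ x h3] using hnn
      have hgx := hsm x h.le (h2.trans hδ2) h3
      have e : D x = g x * ((∑ i, T2 i x) - (∑ i, T2 i x) * η x - 2 * T1 0 x * η1 x
          - T x * η2 x) := by
        simp only [hD, hsum]; ring
      rw [e, Real.norm_eq_abs, abs_mul]
      apply mul_le_mul hgx _ (abs_nonneg _) hε.le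
      obtain ⟨b0, b1, b2⟩ := bd (x 0 / δ - 1)
      have t0 : |∑ i, T2 i x| ≤ C / δ := (hC2 x).trans (by
        rw [le_div_iff₀ hδ]; nlinarith)
      have t1 : |(∑ i, T2 i x) * η x| ≤ C / δ * M := by
        rw [abs_mul]; exact mul_le_mul t0 b0 (abs_nonneg _) (by positivity)
      have t2 : |2 * T1 0 x * η1 x| ≤ 2 * C * (M / δ) := by
        rw [abs_mul, abs_mul, abs_two]
        apply mul_le_mul (by linarith [hC1 x]) _ (abs_nonneg _) (by positivity)
        simp only [η1]
        rw [abs_div, abs_of_pos hδ]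
        gcongr
      have t3 : |T x * η2 x| ≤ C * (2 * δ) * (M / δ / δ) := by
        rw [abs_mul]
        apply mul_le_mul _ _ (abs_nonneg _) (by positivity)
        · refine (hC0 x).trans ?_
          rw [abs_of_pos h]; gcongr
        · simp only [η2]
          rw [abs_div, abs_div, abs_of_pos hδ]
          gcongr
      have e3 : C * (2 * δ) * (M / δ / δ) = 2 * C * M / δ := by field_simp
      have e4 : C * (1 + 5 * M) / δ = C / δ + C / δ * M + 2 * C * (M / δ) + 2 * C * M / δ := by
        field_simp; ring
      rw [e3] at t3
      rw [e4]
      calc _ ≤ |(∑ i, T2 i x) - (∑ i, T2 i x) * η x - 2 * T1 0 x * η1 x| + |T x * η2 x| := abs_sub _ _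
        _ ≤ |(∑ i, T2 i x) - (∑ i, T2 i x) * η x| + |2 * T1 0 x * η1 x| + |T x * η2 x| := by
            gcongr; exact abs_sub _ _
        _ ≤ |(∑ i, T2 i x)| + |(∑ i, T2 i x) * η x| + |2 * T1 0 x * η1 x| + |T x * η2 x| := by
            gcongr; exact abs_sub _ _
        _ ≤ _ := by linarith
    rw [hDint, ← setIntegral_eq_integral_of_forall_compl_eq_zero hD0, ← Real.norm_eq_abs]
    have hv := box_vol (2 * δ) L (by positivity) hL
    have := norm_setIntegral_le_of_norm_le_const (μ := (volume : Measure E4))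
      (s := box (2 * δ) L) (by rw [hv]; exact ENNReal.ofReal_lt_top) hDb
    refine this.trans (le_of_eq ?_)
    rw [Measure.real, hv, ENNReal.toReal_ofReal (by positivity)]
    field_simp
  by_contra hne
  have hpos : 0 < |∫ x, g x * ∑ i, T2 i x| := abs_pos.2 hne
  set A := |∫ x, g x * ∑ i, T2 i x|
  set K := C * (1 + 5 * M) * (2 * (2 * L) ^ 3) with hK
  have hK0 : 0 ≤ K := by positivity
  have := main (A / (2 * (K + 1))) (by positivity)
  have h2 : A / (2 * (K + 1)) * K < A := by
    rw [div_mul_eq_mul_div, div_lt_iff₀ (by positivity)]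
    nlinarith
  linarith

lemma hasDerivAt_pos_pow (n : ℕ) (s : ℝ) :
    HasDerivAt (fun t : ℝ => max t 0 ^ (n + 2)) ((n + 2 : ℕ) * max s 0 ^ (n + 1)) s := by
  rcases lt_trichotomy s 0 with h | h | h
  · have e : (fun t : ℝ => max t 0 ^ (n + 2)) =ᶠ[𝓝 s] fun _ => 0 := by
      filter_upwards [gt_mem_nhds h] with y hy
      rw [max_eq_right hy.le]; simp
    rw [max_eq_right h.le]
    simpa using (hasDerivAt_const s (0 : ℝ)).congr_of_eventuallyEq e
  · subst h
    have h1 : HasDerivWithinAt (fun t : ℝ => max t 0 ^ (n + 2)) 0 (Iic 0) 0 := by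
      refine (hasDerivWithinAt_const (0 : ℝ) (Iic 0) (0 : ℝ)).congr ?_ ?_
      · intro y hy
        rw [max_eq_right hy]; simp
      · simp
    have h2 : HasDerivWithinAt (fun t : ℝ => max t 0 ^ (n + 2)) 0 (Ici 0) 0 := by
      have := (hasDerivAt_pow (n + 2) (0 : ℝ)).hasDerivWithinAt (s := Ici 0)
      simp only [Nat.add_succ_sub_one] at this
      rw [zero_pow (by omega), mul_zero] at this
      refine this.congr ?_ ?_
      · intro y hy
        rw [max_eq_left hy]
      · simp
    have := h1.union h2
    rw [Iic_union_Ici, hasDerivWithinAt_univ] at this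
    simpa using this
  · have e : (fun t : ℝ => max t 0 ^ (n + 2)) =ᶠ[𝓝 s] fun t => t ^ (n + 2) := by
      filter_upwards [lt_mem_nhds h] with y hy
      rw [max_eq_left hy.le]
    rw [max_eq_left h.le]
    exact (hasDerivAt_pow (n + 2) s).congr_of_eventuallyEq e

/-- squared distance -/
noncomputable def sq (p x : EuclideanSpace ℝ (Fin 4)) : ℝ := ∑ i, (x i - p i) ^ 2

/-- truncated paraboloid -/
noncomputable def u (ρ : ℝ) (p x : EuclideanSpace ℝ (Fin 4)) : ℝ := max (ρ - sq p x) 0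

/-- reflection -/
noncomputable def st (p : EuclideanSpace ℝ (Fin 4)) : EuclideanSpace ℝ (Fin 4) :=
  p - (2 * p 0) • ev 0

lemma sq_eq (p x : E4) : sq p x = ‖x - p‖ ^ 2 := by
  rw [EuclideanSpace.norm_sq_eq, sq]; simp

lemma sq_st (p x : E4) : sq (st p) x = sq p x + 4 * x 0 * p 0 := by
  simp [sq, st, Fin.sum_univ_four, ev]; ring

lemma cont_sq (p : E4) : Continuous (sq p) := by unfold sq; fun_prop
lemma cont_u (ρ : ℝ) (p : E4) : Continuous (u ρ p) := by
  have := cont_sq p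
  unfold u; fun_prop

lemma u_nonneg (ρ : ℝ) (p x : E4) : 0 ≤ u ρ p x := le_max_right _ _

lemma sq_nonneg' (p x : E4) : 0 ≤ sq p x := by rw [sq_eq]; positivity

lemma u_le (ρ : ℝ) (hρ : 0 ≤ ρ) (p x : E4) : u ρ p x ≤ ρ :=
  max_le (by linarith [sq_nonneg' p x]) hρ

lemma u_mono {ρ ρ' : ℝ} (h : ρ ≤ ρ') (p x : E4) : u ρ p x ≤ u ρ' p x :=
  max_le_max (by linarith) le_rfl

lemma u_zero (ρ : ℝ) (hρ : 0 ≤ ρ) (p x : E4) (h : ‖p‖ + (ρ + 1) < ‖x‖) : u ρ p x = 0 := by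
  apply max_eq_right
  rw [sq_eq]
  have : ρ + 1 ≤ ‖x - p‖ := by linarith [norm_sub_norm_le x p]
  nlinarith

lemma line_coord (p x : E4) (i : Fin 4) :
    HasLineDerivAt ℝ (fun y : E4 => y i - p i) 1 x (ev i) := by
  unfold HasLineDerivAt
  have : (fun t : ℝ => (x + t • ev i) i - p i) = fun t : ℝ => x i + t - p i := by
    ext t; simp [ev]
  rw [this]
  exact ((hasDerivAt_id (0 : ℝ)).const_add (x i)).sub_const _

lemma line_sq (p x : E4) (i : Fin 4) :
    HasLineDerivAt ℝ (sq p) (2 * (x i - p i)) x (ev i) := by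
  unfold HasLineDerivAt
  have : (fun t : ℝ => sq p (x + t • ev i)) =
      fun t : ℝ => sq p x + 2 * (x i - p i) * t + t ^ 2 := by
    ext t
    fin_cases i <;> simp [sq, Fin.sum_univ_four, ev] <;> ring
  rw [this]
  have h1 := (((hasDerivAt_id (0 : ℝ)).const_mul (2 * (x i - p i))).const_add (sq p x)).fun_add
    (hasDerivAt_pow 2 (0 : ℝ))
  simpa using h1

lemma line_u_pow (n : ℕ) (ρ : ℝ) (p x : E4) (i : Fin 4) :
    HasLineDerivAt ℝ (fun y => u ρ p y ^ (n + 2))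
      (-(2 * (n + 2 : ℕ)) * (x i - p i) * u ρ p x ^ (n + 1)) x (ev i) := by
  have h1 : HasDerivAt (fun t : ℝ => ρ - sq p (x + t • ev i)) (-(2 * (x i - p i))) 0 :=
    HasDerivAt.const_sub ρ (line_sq p x i)
  have h2 : HasDerivAt (fun t : ℝ => max t 0 ^ (n + 2))
      ((n + 2 : ℕ) * max (ρ - sq p x) 0 ^ (n + 1))
      ((fun t : ℝ => ρ - sq p (x + t • ev i)) 0) := by
    simpa using hasDerivAt_pos_pow n (ρ - sq p x)
  have h3 := h2.comp (0 : ℝ) h1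
  unfold HasLineDerivAt
  have e : -(2 * ((n + 2 : ℕ) : ℝ)) * (x i - p i) * u ρ p x ^ (n + 1) =
    (n + 2 : ℕ) * max (ρ - sq p x) 0 ^ (n + 1) * -(2 * (x i - p i)) := by
    unfold u; ring
  rw [e]
  exact h3

lemma exists_bd (f : E4 → ℝ) (hf : Continuous f) (L : ℝ) (h : ∀ x : E4, L < ‖x‖ → f x = 0) :
    ∃ C, 0 ≤ C ∧ ∀ x, |f x| ≤ C := by
  obtain ⟨C, hC⟩ := (isCompact_closedBall (0 : E4) L).exists_bound_of_continuousOn hf.continuousOn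
  refine ⟨max C 0, le_max_right _ _, fun x => ?_⟩
  rcases lt_or_ge L ‖x‖ with h1 | h1
  · rw [h x h1, abs_zero]; exact le_max_right _ _
  · exact (hC x (by simpa using h1)).trans (le_max_left _ _)

/-- first derivative of the test function -/
noncomputable def W1 (ρ : ℝ) (p : EuclideanSpace ℝ (Fin 4)) (i : Fin 4)
    (x : EuclideanSpace ℝ (Fin 4)) : ℝ := -6 * (x i - p i) * u ρ p x ^ 2
/-- second derivative of the test function -/
noncomputable def W2 (ρ : ℝ) (p : EuclideanSpace ℝ (Fin 4)) (i : Fin 4)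
    (x : EuclideanSpace ℝ (Fin 4)) : ℝ := 24 * (x i - p i) ^ 2 * u ρ p x - 6 * u ρ p x ^ 2

lemma line_W (ρ : ℝ) (p x : E4) (i : Fin 4) :
    HasLineDerivAt ℝ (fun y => u ρ p y ^ 3) (W1 ρ p i x) x (ev i) := by
  have := line_u_pow 1 ρ p x i
  norm_num at this
  convert this using 1
  unfold W1; ring

lemma line_W1 (ρ : ℝ) (p x : E4) (i : Fin 4) :
    HasLineDerivAt ℝ (W1 ρ p i) (W2 ρ p i x) x (ev i) := by
  have h := line_u_pow 0 ρ p x i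
  norm_num at h
  have h2 := line_mul (line_coord p x i) h
  have h3 : HasLineDerivAt ℝ (fun y => -6 * ((y i - p i) * u ρ p y ^ 2)) _ x (ev i) :=
    HasDerivAt.const_mul (-6) h2
  have e : W1 ρ p i = (fun y => -6 * ((y i - p i) * u ρ p y ^ 2)) := by
    ext y; unfold W1; ring
  rw [e]
  convert h3 using 1
  unfold W2; ring

lemma cont_W1 (ρ : ℝ) (p : E4) (i : Fin 4) : Continuous (W1 ρ p i) := by
  have := cont_u ρ p
  unfold W1; fun_prop

lemma cont_W2 (ρ : ℝ) (p : E4) (i : Fin 4) : Continuous (W2 ρ p i) := by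
  have := cont_u ρ p
  unfold W2; fun_prop

lemma sum_W2 (ρ : ℝ) (p x : E4) : ∑ i, W2 ρ p i x = 24 * ρ * u ρ p x - 48 * u ρ p x ^ 2 := by
  have h1 : ∑ i, W2 ρ p i x = 24 * sq p x * u ρ p x - 24 * u ρ p x ^ 2 := by
    simp [W2, sq, Fin.sum_univ_four]; ring
  have h2 : u ρ p x * (ρ - sq p x) = u ρ p x ^ 2 := by
    unfold u
    rcases le_total (ρ - sq p x) 0 with h | h
    · rw [max_eq_right h]; simp
    · rw [max_eq_left h]; ring
  rw [h1]; linear_combination (-24) * h2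

/-- the kernel integrals -/
noncomputable def I (g : EuclideanSpace ℝ (Fin 4) → ℝ) (p : EuclideanSpace ℝ (Fin 4)) (k : ℕ)
    (ρ : ℝ) : ℝ := ∫ x, g x * (u ρ p x ^ k - u ρ (st p) x ^ k)

lemma u_zero2 (ρ : ℝ) (hρ : 0 ≤ ρ) (p x : E4) (h : ‖p‖ + ‖st p‖ + (ρ + 1) < ‖x‖) :
    u ρ p x = 0 ∧ u ρ (st p) x = 0 :=
  ⟨u_zero ρ hρ p x (by linarith [norm_nonneg (st p)]),
   u_zero ρ hρ _ x (by linarith [norm_nonneg p])⟩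

lemma int_I (g : E4 → ℝ) (hg : Continuous g) (p : E4) (k : ℕ) (ρ : ℝ) (hρ : 0 ≤ ρ) :
    Integrable (fun x => g x * (u ρ p x ^ k - u ρ (st p) x ^ k)) :=
  integrable_cs _ (hg.mul (((cont_u ρ p).pow k).sub ((cont_u ρ (st p)).pow k)))
    (‖p‖ + ‖st p‖ + (ρ + 1)) (fun x hx => by
      obtain ⟨h1, h2⟩ := u_zero2 ρ hρ p x hx
      simp [h1, h2])

lemma identity (g : E4 → ℝ) (hg : Continuous g) (hg0 : ∀ x : E4, x 0 ≤ 0 → g x = 0)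
    (hd : ∀ x : E4, 0 < x 0 → ContDiffAt ℝ 2 g x)
    (hl : ∀ x : E4, 0 < x 0 → lap g x = 0) (p : E4) (ρ : ℝ) (hρ : 0 ≤ ρ) :
    ρ * I g p 1 ρ = 2 * I g p 2 ρ := by
  set L := ‖p‖ + ‖st p‖ + (ρ + 1)
  have hL : 0 ≤ L := by positivity
  have hL1 : ∀ i, ∀ x : E4, L < ‖x‖ → W1 ρ p i x - W1 ρ (st p) i x = 0 := fun i x hx => by
    obtain ⟨h1, h2⟩ := u_zero2 ρ hρ p x hx
    simp [W1, h1, h2]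
  have hL2 : ∀ i, ∀ x : E4, L < ‖x‖ → W2 ρ p i x - W2 ρ (st p) i x = 0 := fun i x hx => by
    obtain ⟨h1, h2⟩ := u_zero2 ρ hρ p x hx
    simp [W2, h1, h2]
  obtain ⟨C1, hC1, b1⟩ := exists_bd _ ((cont_W1 ρ p 0).sub (cont_W1 ρ (st p) 0)) L (hL1 0)
  obtain ⟨C2, hC2, b2⟩ := exists_bd (fun x => ∑ i, (W2 ρ p i x - W2 ρ (st p) i x))
    (continuous_finsetSum _ fun i _ => (cont_W2 ρ p i).sub (cont_W2 ρ (st p) i)) L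
    (fun x hx => by simp only [hL2 _ x hx]; simp)
  have key := green_bdry g hg hg0 hd hl (fun x => u ρ p x ^ 3 - u ρ (st p) x ^ 3)
    (fun i x => W1 ρ p i x - W1 ρ (st p) i x) (fun i x => W2 ρ p i x - W2 ρ (st p) i x)
    L (3 * ρ ^ 2 * (4 * |p 0|) + C1 + C2) hL (by positivity)
    (((cont_u ρ p).pow 3).sub ((cont_u ρ (st p)).pow 3))
    (fun i => (cont_W1 ρ p i).sub (cont_W1 ρ (st p) i))
    (fun i => (cont_W2 ρ p i).sub (cont_W2 ρ (st p) i))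
    (fun i x => line_sub (line_W ρ p x i) (line_W ρ (st p) x i))
    (fun i x => line_sub (line_W1 ρ p x i) (line_W1 ρ (st p) x i))
    (fun x hx => by
      obtain ⟨h1, h2⟩ := u_zero2 ρ hρ p x hx
      simp [h1, h2])
    hL1 hL2
    (fun x => by
      have a0 := u_nonneg ρ p x
      have b0 := u_nonneg ρ (st p) x
      have a1 := u_le ρ hρ p x
      have b1 := u_le ρ hρ (st p) x
      have hab : |u ρ p x - u ρ (st p) x| ≤ 4 * |p 0| * |x 0| := by
        have := abs_max_sub_max_le_abs (ρ - sq p x) (ρ - sq (st p) x) 0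
        refine this.trans (le_of_eq ?_)
        rw [sq_st]
        have : ρ - sq p x - (ρ - (sq p x + 4 * x 0 * p 0)) = 4 * p 0 * x 0 := by ring
        rw [this, abs_mul, abs_mul]; norm_num
      generalize u ρ p x = a at *
      generalize u ρ (st p) x = b at *
      have e : a ^ 3 - b ^ 3 = (a ^ 2 + a * b + b ^ 2) * (a - b) := by ring
      rw [e, abs_mul, abs_of_nonneg (by positivity)]
      have h3 : a ^ 2 + a * b + b ^ 2 ≤ 3 * ρ ^ 2 := by nlinarith
      calc _ ≤ 3 * ρ ^ 2 * (4 * |p 0| * |x 0|) := by gcongr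
        _ ≤ _ := by
          have : 0 ≤ (C1 + C2) * |x 0| := by positivity
          linarith)
    (fun x => (b1 x).trans (by
      have : 0 ≤ 3 * ρ ^ 2 * (4 * |p 0|) := by positivity
      linarith))
    (fun x => (b2 x).trans (by
      have : 0 ≤ 3 * ρ ^ 2 * (4 * |p 0|) := by positivity
      linarith))
  simp only [Finset.sum_sub_distrib, sum_W2] at key
  have e : ∀ x, g x * (24 * ρ * u ρ p x - 48 * u ρ p x ^ 2 -
      (24 * ρ * u ρ (st p) x - 48 * u ρ (st p) x ^ 2)) =
      24 * ρ * (g x * (u ρ p x ^ 1 - u ρ (st p) x ^ 1)) -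
      48 * (g x * (u ρ p x ^ 2 - u ρ (st p) x ^ 2)) := fun x => by ring
  simp only [e] at key
  rw [integral_sub ((int_I g hg p 1 ρ hρ).const_mul _) ((int_I g hg p 2 ρ hρ).const_mul _),
    integral_const_mul, integral_const_mul] at key
  unfold I
  linarith

lemma deriv_I (g : E4 → ℝ) (hg : Continuous g) (p : E4) (ρ : ℝ) (hρ : 0 < ρ) :
    HasDerivAt (I g p 2) (2 * I g p 1 ρ) ρ := by
  have hbi : Integrable (fun x => |g x| * (2 * (u (ρ + 1) p x + u (ρ + 1) (st p) x))) :=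
    integrable_cs _ (hg.abs.mul (continuous_const.mul ((cont_u _ p).add (cont_u _ (st p)))))
    (‖p‖ + ‖st p‖ + ((ρ + 1) + 1)) (fun x hx => by
      obtain ⟨h1, h2⟩ := u_zero2 (ρ + 1) (by positivity) p x hx
      simp [h1, h2])
  have hdu : ∀ (q x : E4) (r : ℝ), HasDerivAt (fun s => u s q x ^ 2) (2 * u r q x) r := by
    intro q x r
    have h1 := hasDerivAt_pos_pow 0 (r - sq q x)
    have h2 := h1.comp r ((hasDerivAt_id r).sub_const (sq q x))
    simpa [u, Function.comp_def] using h2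
  have := (hasDerivAt_integral_of_dominated_loc_of_deriv_le (μ := (volume : Measure E4))
    (F := fun r x => g x * (u r p x ^ 2 - u r (st p) x ^ 2))
    (F' := fun r x => g x * (2 * u r p x - 2 * u r (st p) x))
    (x₀ := ρ) (s := Metric.ball ρ 1)
    (bound := fun x => |g x| * (2 * (u (ρ + 1) p x + u (ρ + 1) (st p) x)))
    (Metric.ball_mem_nhds ρ one_pos)
    (Eventually.of_forall fun r => (hg.mul (((cont_u r p).pow 2).sub
      ((cont_u r (st p)).pow 2))).aestronglyMeasurable)
    (int_I g hg p 2 ρ hρ.le)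
    (hg.mul ((continuous_const.mul (cont_u ρ p)).sub
      (continuous_const.mul (cont_u ρ (st p))))).aestronglyMeasurable
    (Eventually.of_forall fun x r hr => by
      rw [Metric.mem_ball, Real.dist_eq] at hr
      have hr' : r ≤ ρ + 1 := by linarith [(abs_lt.1 hr).2]
      rw [norm_mul, Real.norm_eq_abs, Real.norm_eq_abs]
      gcongr
      have a0 := u_nonneg r p x
      have b0 := u_nonneg r (st p) x
      have a1 := u_mono hr' p x
      have b1 := u_mono hr' (st p) x
      rw [abs_le]; constructor <;> linarith)
    hbi
    (Eventually.of_forall fun x r _ => ((hdu p x r).sub (hdu (st p) x r)).const_mul (g x))).2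
  have e : ∫ x, g x * (2 * u ρ p x - 2 * u ρ (st p) x) = 2 * I g p 1 ρ := by
    rw [I, ← integral_const_mul]
    congr 1; ext x; ring
  rw [e] at this
  exact this

lemma I_scale (g : E4 → ℝ) (hg : Continuous g) (hg0 : ∀ x : E4, x 0 ≤ 0 → g x = 0)
    (hd : ∀ x : E4, 0 < x 0 → ContDiffAt ℝ 2 g x)
    (hl : ∀ x : E4, 0 < x 0 → lap g x = 0) (p : E4) (ρ : ℝ) (hρ : 0 < ρ) :
    I g p 2 ρ = I g p 2 1 * ρ ^ 4 := by
  have hder : ∀ r, 0 < r → HasDerivAt (fun r => I g p 2 r / r ^ 4) 0 r := by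
    intro r hr
    have h1 := (deriv_I g hg p r hr).div (hasDerivAt_pow 4 r) (by positivity)
    have h2 := identity g hg hg0 hd hl p r hr.le
    have e : (2 * I g p 1 r * r ^ 4 - I g p 2 r * (((4 : ℕ) : ℝ) * r ^ (4 - 1))) / (r ^ 4) ^ 2
        = 0 := by
      rw [div_eq_zero_iff]; left
      norm_num
      linear_combination (2 * r ^ 3) * h2
    rw [e] at h1
    exact h1
  have hc := isOpen_Ioi.is_const_of_deriv_eq_zero (s := Ioi (0 : ℝ)) isPreconnected_Ioi
    (f := fun r => I g p 2 r / r ^ 4)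
    (fun r hr => (hder r hr).differentiableAt.differentiableWithinAt)
    (fun r hr => (hder r hr).deriv) (x := ρ) (y := 1) hρ (by simp)
  simp at hc
  field_simp at hc
  linarith

lemma I_compare (g : E4 → ℝ) (hg : Continuous g) (hg0 : ∀ x : E4, x 0 ≤ 0 → g x = 0)
    (hn : ∀ x, 0 ≤ g x) (p q : E4) (hp : 0 < p 0) (hq : 0 < q 0) (R : ℝ) (hR : 0 < R) :
    q 0 * I g p 2 (R ^ 2) ≤ p 0 * I g q 2 ((R + ‖p - st q‖) ^ 2) := by
  set K := ‖p - st q‖ with hK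
  have hK0 : 0 ≤ K := norm_nonneg _
  unfold I
  rw [← integral_const_mul, ← integral_const_mul]
  apply integral_mono ((int_I g hg p 2 _ (by positivity)).const_mul _)
    ((int_I g hg q 2 _ (by positivity)).const_mul _)
  intro x
  simp only
  rcases le_or_gt (x 0) 0 with hx | hx
  · simp [hg0 x hx]
  have key : q 0 * (u (R ^ 2) p x ^ 2 - u (R ^ 2) (st p) x ^ 2) ≤
      p 0 * (u ((R + K) ^ 2) q x ^ 2 - u ((R + K) ^ 2) (st q) x ^ 2) := by
    have hxp : 0 < 4 * x 0 * p 0 := by positivity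
    have hxq : 0 < 4 * x 0 * q 0 := by positivity
    have k1 : u (R ^ 2) p x ^ 2 - u (R ^ 2) (st p) x ^ 2 ≤
        2 * (4 * x 0 * p 0) * u (R ^ 2) p x := by
      have a0 := u_nonneg (R ^ 2) p x
      have b0 := u_nonneg (R ^ 2) (st p) x
      have hab : u (R ^ 2) p x - u (R ^ 2) (st p) x ≤ 4 * x 0 * p 0 := by
        have h1 : R ^ 2 - sq (st p) x ≤ u (R ^ 2) (st p) x := le_max_left _ _
        rw [sq_st] at h1
        have : u (R ^ 2) p x ≤ u (R ^ 2) (st p) x + 4 * x 0 * p 0 :=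
          max_le (by linarith) (by linarith)
        linarith
      nlinarith [mul_le_mul_of_nonneg_left hab a0,
        sq_nonneg (u (R ^ 2) p x - u (R ^ 2) (st p) x)]
    have k2 : 2 * (4 * x 0 * q 0) * u ((R + K) ^ 2) (st q) x ≤
        u ((R + K) ^ 2) q x ^ 2 - u ((R + K) ^ 2) (st q) x ^ 2 := by
      have h1 : (R + K) ^ 2 - sq q x ≤ u ((R + K) ^ 2) q x := le_max_left _ _
      have h2 := sq_st q x
      have a0 := u_nonneg ((R + K) ^ 2) q x
      rcases le_total ((R + K) ^ 2 - sq (st q) x) 0 with h | h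
      · have : u ((R + K) ^ 2) (st q) x = 0 := max_eq_right h
        rw [this]; nlinarith
      · have : u ((R + K) ^ 2) (st q) x = (R + K) ^ 2 - sq (st q) x := max_eq_left h
        have h3 : u ((R + K) ^ 2) (st q) x + 4 * x 0 * q 0 ≤ u ((R + K) ^ 2) q x := by
          linarith
        have b0 := u_nonneg ((R + K) ^ 2) (st q) x
        nlinarith
    have k3 : u (R ^ 2) p x ≤ u ((R + K) ^ 2) (st q) x := by
      apply max_le _ (u_nonneg _ _ _)
      rcases le_total (R ^ 2 - sq p x) 0 with h | h
      · exact h.trans (u_nonneg _ _ _)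
      refine le_trans ?_ (le_max_left _ _)
      rw [sq_eq] at h
      rw [sq_eq, sq_eq]
      have t : ‖x - st q‖ ≤ ‖x - p‖ + K := by
        rw [hK]
        calc ‖x - st q‖ = ‖(x - p) + (p - st q)‖ := by congr 1; abel
          _ ≤ _ := norm_add_le _ _
      have t2 : ‖x - p‖ ≤ R := by
        apply le_of_sq_le_sq _ hR.le
        linarith
      have t3 : ‖x - st q‖ ^ 2 ≤ (‖x - p‖ + K) ^ 2 := by gcongr
      nlinarith [norm_nonneg (x - p)]
    calc q 0 * (u (R ^ 2) p x ^ 2 - u (R ^ 2) (st p) x ^ 2)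
        ≤ q 0 * (2 * (4 * x 0 * p 0) * u (R ^ 2) p x) := by gcongr
      _ = p 0 * (2 * (4 * x 0 * q 0) * u (R ^ 2) p x) := by ring
      _ ≤ p 0 * (2 * (4 * x 0 * q 0) * u ((R + K) ^ 2) (st q) x) := by gcongr
      _ ≤ _ := by gcongr
  calc _ = g x * (q 0 * (u (R ^ 2) p x ^ 2 - u (R ^ 2) (st p) x ^ 2)) := by ring
    _ ≤ g x * (p 0 * (u ((R + K) ^ 2) q x ^ 2 - u ((R + K) ^ 2) (st q) x ^ 2)) :=
        mul_le_mul_of_nonneg_left key (hn x)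
    _ = _ := by ring

lemma c_compare (g : E4 → ℝ) (hg : Continuous g) (hg0 : ∀ x : E4, x 0 ≤ 0 → g x = 0)
    (hd : ∀ x : E4, 0 < x 0 → ContDiffAt ℝ 2 g x)
    (hl : ∀ x : E4, 0 < x 0 → lap g x = 0)
    (hn : ∀ x, 0 ≤ g x) (p q : E4) (hp : 0 < p 0) (hq : 0 < q 0) :
    q 0 * I g p 2 1 ≤ p 0 * I g q 2 1 := by
  set K := ‖p - st q‖ with hK
  have hK0 : 0 ≤ K := norm_nonneg _
  have h : ∀ R : ℝ, 0 < R → q 0 * I g p 2 1 ≤ p 0 * I g q 2 1 * (1 + K * R⁻¹) ^ 8 := by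
    intro R hR
    have := I_compare g hg hg0 hn p q hp hq R hR
    rw [← hK, I_scale g hg hg0 hd hl p (R ^ 2) (by positivity),
      I_scale g hg hg0 hd hl q ((R + K) ^ 2) (by positivity)] at this
    have e : (R + K) = R * (1 + K * R⁻¹) := by field_simp
    rw [e] at this
    have h8 : 0 < R ^ 8 := by positivity
    refine le_of_mul_le_mul_right ?_ h8
    calc _ = q 0 * (I g p 2 1 * (R ^ 2) ^ 4) := by ring
      _ ≤ _ := this
      _ = _ := by ring
  have ht : Tendsto (fun R : ℝ => p 0 * I g q 2 1 * (1 + K * R⁻¹) ^ 8) atTop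
      (𝓝 (p 0 * I g q 2 1 * (1 + K * 0) ^ 8)) :=
    (((tendsto_inv_atTop_zero.const_mul K).const_add 1).pow 8).const_mul _
  simp only [mul_zero, add_zero, one_pow, mul_one] at ht
  refine ge_of_tendsto ht ?_
  filter_upwards [eventually_gt_atTop 0] with R hR using h R hR

/-- mass -/
noncomputable def J (ρ : ℝ) : ℝ := ∫ x, u ρ 0 x ^ 2

lemma J_eq (ρ : ℝ) (p : E4) : ∫ x, u ρ p x ^ 2 = J ρ := by
  have : ∀ x, u ρ p x ^ 2 = (fun y => u ρ 0 y ^ 2) (x - p) := by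
    intro x; simp [u, sq]
  simp_rw [this]
  exact integral_sub_right_eq_self (fun y => u ρ 0 y ^ 2) p

lemma int_u2 (ρ : ℝ) (hρ : 0 ≤ ρ) (p : E4) : Integrable (fun x => u ρ p x ^ 2) :=
  integrable_cs _ ((cont_u ρ p).pow 2) (‖p‖ + (ρ + 1)) (fun x hx => by
    simp [u_zero ρ hρ p x hx])

lemma J_pos (ρ : ℝ) (hρ : 0 < ρ) : 0 < J ρ := by
  apply Continuous.integral_pos_of_hasCompactSupport_nonneg_nonzero (x := 0)
    ((cont_u ρ 0).pow 2)
  · apply HasCompactSupport.intro (isCompact_closedBall (0 : E4) (‖(0 : E4)‖ + (ρ + 1)))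
    intro x hx
    have := u_zero ρ hρ.le 0 x (by simpa using hx)
    simp [this]
  · intro x; exact sq_nonneg _
  · have : u ρ 0 0 = ρ := by simp [u, sq, hρ.le]
    rw [Pi.pow_apply, this]; positivity

lemma local_approx (g : E4 → ℝ) (hg : Continuous g) (hg0 : ∀ x : E4, x 0 ≤ 0 → g x = 0)
    (p : E4) (hp : 0 < p 0) (ε : ℝ) (hε : 0 < ε) :
    ∃ r, 0 < r ∧ ∀ ρ, 0 < ρ → ρ ≤ r → |I g p 2 ρ - g p * J ρ| ≤ ε * J ρ := by
  obtain ⟨d, hd, hgd⟩ := Metric.continuous_iff.1 hg p ε hε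
  refine ⟨min (d ^ 2) (p 0 ^ 2), by positivity, fun ρ hρ hr => ?_⟩
  have hr1 : ρ ≤ d ^ 2 := hr.trans (min_le_left _ _)
  have hr2 : ρ ≤ p 0 ^ 2 := hr.trans (min_le_right _ _)
  have e : ∀ x, g x * (u ρ p x ^ 2 - u ρ (st p) x ^ 2) = g x * u ρ p x ^ 2 := by
    intro x
    rcases le_or_gt (x 0) 0 with hx | hx
    · simp [hg0 x hx]
    have : u ρ (st p) x = 0 := by
      apply max_eq_right
      have h1 : (x 0 - p 0) ^ 2 ≤ sq p x := by
        unfold sq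
        exact Finset.single_le_sum (f := fun i => (x i - p i) ^ 2) (fun i _ => sq_nonneg _)
          (Finset.mem_univ 0)
      rw [sq_st]
      nlinarith
    rw [this]; ring
  have hI : Integrable (fun x => g x * u ρ p x ^ 2) := by
    have := int_I g hg p 2 ρ hρ.le
    simpa only [e] using this
  have e2 : I g p 2 ρ - g p * J ρ = ∫ x, (g x - g p) * u ρ p x ^ 2 := by
    unfold I
    simp only [e]
    rw [← J_eq ρ p, ← integral_const_mul, ← integral_sub hI ((int_u2 ρ hρ.le p).const_mul _)]
    congr 1; ext x; ring
  rw [e2, ← J_eq ρ p, ← integral_const_mul, ← Real.norm_eq_abs]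
  apply norm_integral_le_of_norm_le ((int_u2 ρ hρ.le p).const_mul ε)
  refine Eventually.of_forall fun x => ?_
  rw [norm_mul, Real.norm_eq_abs, Real.norm_eq_abs, abs_of_nonneg (sq_nonneg (u ρ p x))]
  rcases le_or_gt ρ (sq p x) with h | h
  · have : u ρ p x = 0 := max_eq_right (by linarith)
    simp [this]
  · apply mul_le_mul_of_nonneg_right _ (sq_nonneg _)
    have hx : dist x p < d := by
      rw [dist_eq_norm]
      rw [sq_eq] at h
      exact lt_of_pow_lt_pow_left₀ 2 hd.le (by linarith)
    have := hgd x hx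
    rw [Real.dist_eq] at this
    exact this.le

lemma g_compare (g : E4 → ℝ) (hg : Continuous g) (hg0 : ∀ x : E4, x 0 ≤ 0 → g x = 0)
    (hd : ∀ x : E4, 0 < x 0 → ContDiffAt ℝ 2 g x)
    (hl : ∀ x : E4, 0 < x 0 → lap g x = 0)
    (hn : ∀ x, 0 ≤ g x) (p q : E4) (hp : 0 < p 0) (hq : 0 < q 0) :
    q 0 * g p ≤ p 0 * g q := by
  have main : ∀ ε > 0, q 0 * g p ≤ p 0 * g q + ε * (p 0 + q 0) := by
    intro ε hε
    obtain ⟨r1, hr1, h1⟩ := local_approx g hg hg0 p hp ε hε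
    obtain ⟨r2, hr2, h2⟩ := local_approx g hg hg0 q hq ε hε
    set ρ := min r1 r2
    have hρ : 0 < ρ := lt_min hr1 hr2
    have a1 := (abs_le.1 (h1 ρ hρ (min_le_left _ _))).1
    have a2 := (abs_le.1 (h2 ρ hρ (min_le_right _ _))).2
    have hJ := J_pos ρ hρ
    have hc := c_compare g hg hg0 hd hl hn p q hp hq
    have hc2 : q 0 * I g p 2 ρ ≤ p 0 * I g q 2 ρ := by
      rw [I_scale g hg hg0 hd hl p ρ hρ, I_scale g hg hg0 hd hl q ρ hρ]
      have : 0 ≤ ρ ^ 4 := by positivity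
      nlinarith
    refine le_of_mul_le_mul_right ?_ hJ
    have b1 := mul_le_mul_of_nonneg_left a1 hq.le
    have b2 := mul_le_mul_of_nonneg_left a2 hp.le
    nlinarith
  by_contra hcon
  push Not at hcon
  have hs : 0 < p 0 + q 0 := by positivity
  have := main ((q 0 * g p - p 0 * g q) / (2 * (p 0 + q 0)))
    (div_pos (by linarith) (by positivity))
  have e : (q 0 * g p - p 0 * g q) / (2 * (p 0 + q 0)) * (p 0 + q 0) =
      (q 0 * g p - p 0 * g q) / 2 := by field_simp
  rw [e] at this
  linarith

end BB

/-- **Boas–Boas representation.** A function continuous on the closed half-space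
`{x₁ ≥ 0} ⊆ ℝ⁴`, harmonic and non-negative on the open half-space `{x₁ > 0}`, and
vanishing on the boundary `{x₁ = 0}`, equals `a·x₁` for some constant `a ≥ 0`. -/
theorem boas_boas_halfspace (h : EuclideanSpace ℝ (Fin 4) → ℝ)
    (hcont : ContinuousOn h {x : EuclideanSpace ℝ (Fin 4) | 0 ≤ x 0})
    (hdiff : ∀ x : EuclideanSpace ℝ (Fin 4), 0 < x 0 → ContDiffAt ℝ 2 h x)
    (hharm : ∀ x : EuclideanSpace ℝ (Fin 4), 0 < x 0 → lap h x = 0)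
    (hnonneg : ∀ x : EuclideanSpace ℝ (Fin 4), 0 < x 0 → 0 ≤ h x)
    (hbdry : ∀ x : EuclideanSpace ℝ (Fin 4), x 0 = 0 → h x = 0) :
    ∃ a : ℝ, 0 ≤ a ∧ ∀ x : EuclideanSpace ℝ (Fin 4), 0 ≤ x 0 → h x = a * x 0 := by
  open Topology in
  set π : EuclideanSpace ℝ (Fin 4) → EuclideanSpace ℝ (Fin 4) :=
    fun x => x + (max (x 0) 0 - x 0) • BB.ev 0 with hπ
  have π0 : ∀ x, π x 0 = max (x 0) 0 := by intro x; simp [hπ, BB.ev]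
  have πid : ∀ x, 0 ≤ x 0 → π x = x := by intro x hx; simp [hπ, max_eq_left hx]
  have πc : Continuous π := by fun_prop
  set g : EuclideanSpace ℝ (Fin 4) → ℝ := fun x => h (π x) with hgdef
  have hgc : Continuous g := hcont.comp_continuous πc (fun x => by
    change 0 ≤ π x 0
    rw [π0]; exact le_max_right _ _)
  have hg0 : ∀ x : EuclideanSpace ℝ (Fin 4), x 0 ≤ 0 → g x = 0 := fun x hx =>
    hbdry _ (by rw [π0, max_eq_right hx])
  have hev : ∀ x : EuclideanSpace ℝ (Fin 4), 0 < x 0 → g =ᶠ[𝓝 x] h := by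
    intro x hx
    have ho : IsOpen {x : EuclideanSpace ℝ (Fin 4) | 0 < x 0} :=
      isOpen_lt continuous_const (BB.cont_coord 0)
    filter_upwards [ho.mem_nhds hx] with y hy
    simp only [hgdef]
    rw [πid y (le_of_lt hy)]
  have hgd : ∀ x : EuclideanSpace ℝ (Fin 4), 0 < x 0 → ContDiffAt ℝ 2 g x := fun x hx =>
    (hdiff x hx).congr_of_eventuallyEq (hev x hx)
  have hgl : ∀ x : EuclideanSpace ℝ (Fin 4), 0 < x 0 → lap g x = 0 := by
    intro x hx
    rw [← hharm x hx, lap, lap, ((hev x hx).iteratedFDeriv ℝ 2).eq_of_nhds]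
  have hgh : ∀ x : EuclideanSpace ℝ (Fin 4), 0 ≤ x 0 → g x = h x := by
    intro x hx; simp only [hgdef]; rw [πid x hx]
  have hgn : ∀ x, 0 ≤ g x := by
    intro x
    rcases le_or_gt (x 0) 0 with hx | hx
    · rw [hg0 x hx]
    · rw [hgh x hx.le]; exact hnonneg x hx
  have he : (BB.ev 0) 0 = (1 : ℝ) := by simp [BB.ev]
  refine ⟨g (BB.ev 0), hgn _, fun x hx => ?_⟩
  rcases hx.eq_or_lt with hx0 | hx0
  · rw [hbdry x hx0.symm, ← hx0, mul_zero]
  · have h1 := BB.g_compare g hgc hg0 hgd hgl hgn x (BB.ev 0) hx0 (by rw [he]; exact one_pos)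
    have h2 := BB.g_compare g hgc hg0 hgd hgl hgn (BB.ev 0) x (by rw [he]; exact one_pos) hx0
    rw [he] at h1 h2
    rw [← hgh x hx]
    linarith
end

section
/- Let H = {x ∈ ℝ⁴ : x₁ > 0} be the open upper half-space and let u be a real-valued function smooth on an open neighborhood of the closed half-space H̄ = {x ∈ ℝ⁴ : x₁ ≥ 0}. Assume Δ²u = 0 on H, Δu ≤ 0 on H, and Δu(x) = 0 at every boundary point x with x₁ = 0. Then there exists a constant a ≥ 0 such that Δu(x) = −a·x₁ for all x ∈ H̄. (Intermediate step in the paper's Liouville argument: since −Δu is harmonic, non-negative, and vanishes on the boundary, it equals a·x₁.) -/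
open MeasureTheory Filter Topology

/-- `ℝ⁴`. -/
abbrev E4 := EuclideanSpace ℝ (Fin 4)

/-- standard basis vector -/
noncomputable abbrev ee (i : Fin 4) : E4 := EuclideanSpace.single i (1 : ℝ)

/-- radial bump -/
noncomputable def ph (L : ℝ) (z : E4) : ℝ := expNegInvGlue (L - ‖z‖ ^ 2)

/-- radial antiderivative -/
noncomputable def ps (L : ℝ) (z : E4) : ℝ :=
  (1 / 2) * ∫ r in L..(‖z‖ ^ 2), expNegInvGlue (L - r)

lemma glue_cont : Continuous expNegInvGlue := (expNegInvGlue.contDiff (n := 0)).continuous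

lemma ph_contDiff (L : ℝ) (n : ℕ∞) : ContDiff ℝ n (ph L) := by
  unfold ph
  exact expNegInvGlue.contDiff.comp (contDiff_const.sub (contDiff_norm_sq ℝ))

lemma ph_cont (L : ℝ) : Continuous (ph L) := (ph_contDiff L 0).continuous

lemma ph_nonneg (L : ℝ) (z : E4) : 0 ≤ ph L z := expNegInvGlue.nonneg _

lemma ph_zero {L : ℝ} {z : E4} (h : L ≤ ‖z‖ ^ 2) : ph L z = 0 :=
  expNegInvGlue.zero_of_nonpos (by linarith)

lemma ps_zero {L : ℝ} {z : E4} (h : L ≤ ‖z‖ ^ 2) : ps L z = 0 := by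
  unfold ps
  rw [intervalIntegral.integral_congr (g := fun _ => (0 : ℝ))]
  · simp
  · intro r hr
    rw [Set.uIcc_of_le h] at hr
    exact expNegInvGlue.zero_of_nonpos (by linarith [hr.1])

lemma ph_supp (L : ℝ) : HasCompactSupport (ph L) := by
  refine HasCompactSupport.intro (isCompact_closedBall (0 : E4) (1 + |L|)) fun z hz => ph_zero ?_
  simp only [Metric.mem_closedBall, dist_zero_right, not_le] at hz
  nlinarith [le_abs_self L, abs_nonneg L]

lemma ps_supp (L : ℝ) : HasCompactSupport (ps L) := by
  refine HasCompactSupport.intro (isCompact_closedBall (0 : E4) (1 + |L|)) fun z hz => ps_zero ?_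
  simp only [Metric.mem_closedBall, dist_zero_right, not_le] at hz
  nlinarith [le_abs_self L, abs_nonneg L]

lemma ps_hasFDerivAt (L : ℝ) (z : E4) : HasFDerivAt (ps L) (ph L z • innerSL ℝ z) z := by
  have hc : Continuous (fun r : ℝ => expNegInvGlue (L - r)) :=
    glue_cont.comp (continuous_const.sub continuous_id)
  have h1 : HasDerivAt (fun s : ℝ => ∫ r in L..s, expNegInvGlue (L - r))
      (expNegInvGlue (L - ‖z‖ ^ 2)) (‖z‖ ^ 2) :=
    intervalIntegral.integral_hasDerivAt_right (hc.intervalIntegrable _ _)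
      hc.aestronglyMeasurable.stronglyMeasurableAtFilter hc.continuousAt
  have h2 : HasFDerivAt (fun z : E4 => ‖z‖ ^ 2) (2 • innerSL ℝ z) z :=
    (hasStrictFDerivAt_norm_sq z).hasFDerivAt
  have h3 := (h1.comp_hasFDerivAt z h2).const_mul (1 / 2 : ℝ)
  refine h3.congr_fderiv ?_
  ext y
  simp [ph]
  ring

lemma ps_cont (L : ℝ) : Continuous (ps L) :=
  continuous_iff_continuousAt.2 fun z => (ps_hasFDerivAt L z).continuousAt

lemma int_ph {L : ℝ} {f : E4 → ℝ} (hf : Continuous f) : Integrable (fun z => f z * ph L z) :=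
  (hf.mul (ph_cont L)).integrable_of_hasCompactSupport ((ph_supp L).mul_left)

lemma int_ps {L : ℝ} {f : E4 → ℝ} (hf : Continuous f) : Integrable (fun z => f z * ps L z) :=
  (hf.mul (ps_cont L)).integrable_of_hasCompactSupport ((ps_supp L).mul_left)

lemma sum_ee (z : E4) : z = ∑ i, z i • ee i := by
  ext j
  simp [Fin.sum_univ_four]
  fin_cases j <;> simp

lemma key {V : E4 → ℝ} {V' : E4 → E4 →L[ℝ] ℝ} {V'' : E4 → E4 →L[ℝ] E4 →L[ℝ] ℝ}
    (h1 : ∀ x, HasFDerivAt V (V' x) x) (h2 : ∀ x, HasFDerivAt V' (V'' x) x)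
    (hc : Continuous V'') (hh : ∀ x, ∑ i, V'' x (ee i) (ee i) = 0)
    (L : ℝ) (x : E4) (α β t : ℝ) :
    HasDerivAt (fun t : ℝ => ∫ z, V (x + t • z) * ((α + β * z 0) * ph L z))
      (-β * ∫ z, V' (x + t • z) (ee 0) * ps L z) t := by
  have cV : Continuous V := continuous_iff_continuousAt.2 fun z => (h1 z).continuousAt
  have cV' : Continuous V' := continuous_iff_continuousAt.2 fun z => (h2 z).continuousAt
  have hq : Continuous fun z : E4 => α + β * z 0 := by fun_prop
  have hF' : Continuous (fun p : ℝ × E4 => V' (x + p.1 • p.2) p.2 * ((α + β * p.2 0) * ph L p.2)) := by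
    have := ph_cont L
    fun_prop
  have hd : HasDerivAt (fun t : ℝ => ∫ z, V (x + t • z) * ((α + β * z 0) * ph L z))
      (∫ z, V' (x + t • z) z * ((α + β * z 0) * ph L z)) t := by
    have hK : IsCompact ((Metric.closedBall t 1) ×ˢ (Metric.closedBall (0 : E4) (1 + |L|))) :=
      (isCompact_closedBall _ _).prod (isCompact_closedBall _ _)
    obtain ⟨C, hC⟩ := hK.exists_bound_of_continuousOn hF'.continuousOn
    refine (hasDerivAt_integral_of_dominated_loc_of_deriv_le (μ := volume)
      (s := Metric.closedBall t 1)
      (F := fun (t : ℝ) (z : E4) => V (x + t • z) * ((α + β * z 0) * ph L z))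
      (F' := fun (t : ℝ) (z : E4) => V' (x + t • z) z * ((α + β * z 0) * ph L z))
      (bound := (Metric.closedBall (0 : E4) (1 + |L|)).indicator (fun _ => C))
      (Metric.closedBall_mem_nhds t one_pos) ?_ ?_ ?_ ?_ ?_ ?_).2
    · refine Eventually.of_forall fun s => Continuous.aestronglyMeasurable ?_
      have := ph_cont L
      fun_prop
    · have := int_ph (L := L) (f := fun z => V (x + t • z) * (α + β * z 0)) (by fun_prop)
      simpa only [mul_assoc] using this
    · refine Continuous.aestronglyMeasurable ?_
      exact hF'.comp (Continuous.prodMk continuous_const continuous_id)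
    · refine Eventually.of_forall fun z s hs => ?_
      by_cases hz : z ∈ Metric.closedBall (0 : E4) (1 + |L|)
      · rw [Set.indicator_of_mem hz]
        exact hC (s, z) ⟨hs, hz⟩
      · rw [Set.indicator_of_notMem hz, ph_zero]
        · simp
        · simp only [Metric.mem_closedBall, dist_zero_right, not_le] at hz
          nlinarith [le_abs_self L, abs_nonneg L]
    · exact (integrable_indicator_iff measurableSet_closedBall).2
        (integrableOn_const (measure_closedBall_lt_top.ne))
    · refine Eventually.of_forall fun z s _ => ?_
      have hl : HasDerivAt (fun s : ℝ => x + s • z) z s := by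
        simpa using ((hasDerivAt_id s).smul_const z).const_add x
      exact ((h1 _).comp_hasDerivAt s hl).mul_const _
  have hg : ∀ i : Fin 4, ∀ z : E4, HasFDerivAt (fun z : E4 => V' (x + t • z) (ee i) * (α + β * z 0))
      ((V' (x + t • z) (ee i)) • (β • (EuclideanSpace.proj 0 : E4 →L[ℝ] ℝ)) + (α + β * z 0) •
        (t • ((V'' (x + t • z)).flip (ee i)))) z := by
    intro i z
    have ha : HasFDerivAt (fun z : E4 => x + t • z) (t • ContinuousLinearMap.id ℝ E4) z :=
      ((hasFDerivAt_id z).const_smul t).const_add x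
    have hb := (h2 (x + t • z)).comp z ha
    have hb' : HasFDerivAt (fun z : E4 => V' (x + t • z) (ee i))
        (t • ((V'' (x + t • z)).flip (ee i))) z := by
      refine (hb.clm_apply (hasFDerivAt_const (ee i) z)).congr_fderiv ?_
      ext y
      simp
    have hcc : HasFDerivAt (fun z : E4 => α + β * z 0)
        (β • (EuclideanSpace.proj 0 : E4 →L[ℝ] ℝ)) z :=
      (((EuclideanSpace.proj 0 : E4 →L[ℝ] ℝ).hasFDerivAt).const_mul β).const_add α
    exact hb'.mul hcc
  have ibp : ∀ i : Fin 4, ∫ z, (V' (x + t • z) (ee i) * (α + β * z 0)) * (z i * ph L z) =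
      - ∫ z, (V' (x + t • z) (ee i) * (β * (ee i) 0) +
        (α + β * z 0) * (t * V'' (x + t • z) (ee i) (ee i))) * ps L z := by
    intro i
    have := integral_bilinear_hasFDerivAt_right_eq_neg_left_of_integrable (μ := volume)
      (B := ContinuousLinearMap.mul ℝ ℝ) (v := ee i)
      (f := fun z : E4 => V' (x + t • z) (ee i) * (α + β * z 0)) (g := ps L)
      (f' := fun z => ((V' (x + t • z) (ee i)) • (β • (EuclideanSpace.proj 0 : E4 →L[ℝ] ℝ)) + (α + β * z 0) •
        (t • ((V'' (x + t • z)).flip (ee i)))))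
      (g' := fun z => ph L z • innerSL ℝ z) ?_ ?_ ?_ (fun z _ => hg i z)
      (fun z _ => ps_hasFDerivAt L z)
    · simpa [mul_comm (ph L _), EuclideanSpace.inner_single_right, add_mul] using this
    · refine int_ps (f := fun z => V' (x + t • z) (ee i) * (β * (ee i) 0) +
        (α + β * z 0) * (t * V'' (x + t • z) (ee i) (ee i))) ?_
      fun_prop
    · have := int_ph (L := L) (f := fun z => (V' (x + t • z) (ee i) * (α + β * z 0)) * z i) (by fun_prop)
      refine this.congr (Eventually.of_forall fun z => ?_)
      simp [EuclideanSpace.inner_single_right]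
      ring
    · refine int_ps ?_
      fun_prop
  have e1 : ∫ z, V' (x + t • z) z * ((α + β * z 0) * ph L z) =
      ∑ i, ∫ z, (V' (x + t • z) (ee i) * (α + β * z 0)) * (z i * ph L z) := by
    rw [← integral_finsetSum]
    · refine integral_congr_ae (Eventually.of_forall fun z => ?_)
      have : V' (x + t • z) z = ∑ i, z i * V' (x + t • z) (ee i) := by
        conv_lhs => rw [sum_ee z, map_sum]
        rw [← sum_ee z]
        simp only [map_smul, smul_eq_mul]
      simp only [this, Finset.sum_mul]
      exact Finset.sum_congr rfl fun i _ => by ring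
    · intro i _
      have := int_ph (L := L) (f := fun z => (V' (x + t • z) (ee i) * (α + β * z 0)) * z i) (by fun_prop)
      simpa only [mul_assoc] using this
  convert hd using 1
  rw [e1]
  simp_rw [ibp]
  rw [Finset.sum_neg_distrib, ← integral_finsetSum]
  · rw [neg_mul, ← integral_const_mul]
    congr 1
    refine integral_congr_ae (Eventually.of_forall fun z => ?_)
    have := hh (x + t • z)
    simp only [Fin.sum_univ_four] at this ⊢
    simp
    linear_combination (-(α + β * z 0) * t * ps L z) * this
  · intro i _
    refine int_ps ?_
    fun_prop

lemma diff1 {G : Type*} [NormedAddCommGroup G] [NormedSpace ℝ G] {F : E4 → G} {C : ℝ}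
    (hF : Differentiable ℝ F) (hC : ∀ z, ‖fderiv ℝ F z‖ ≤ C) (y z : E4) :
    ‖F y - F z‖ ≤ C * ‖y - z‖ :=
  convex_univ.norm_image_sub_le_of_norm_fderiv_le (fun w _ => hF w) (fun w _ => hC w)
    (Set.mem_univ z) (Set.mem_univ y)

lemma fderiv_shift {G : Type*} [NormedAddCommGroup G] [NormedSpace ℝ G] {F : E4 → G}
    (hF : Differentiable ℝ F) (s z : E4) :
    HasFDerivAt (fun z => F (z + s)) (fderiv ℝ F (z + s)) z := by
  have h := (hF (z + s)).hasFDerivAt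
  exact (hasFDerivAt_comp_add_right s).2 h

lemma diff2 {G : Type*} [NormedAddCommGroup G] [NormedSpace ℝ G] {F : E4 → G} {C : ℝ}
    (hF : Differentiable ℝ F) (hF' : Differentiable ℝ (fderiv ℝ F))
    (hC : ∀ z, ‖fderiv ℝ (fderiv ℝ F) z‖ ≤ C) (z s : E4) :
    ‖F (z + s) + F (z + -s) - (2 : ℝ) • F z‖ ≤ C * ‖s‖ * ‖s‖ := by
  have hQ : ∀ w, HasFDerivAt (fun w => F w - F (w + -s)) (fderiv ℝ F w - fderiv ℝ F (w + -s)) w :=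
    fun w => (hF w).hasFDerivAt.sub (fderiv_shift hF (-s) w)
  have := diff1 (F := fun w => F w - F (w + -s)) (C := C * ‖s‖)
    (fun w => (hQ w).differentiableAt) (fun w => ?_) (z + s) z
  · convert this using 2
    · simp only [add_neg_cancel_right, two_smul]; abel
    · simp
  · rw [(hQ w).fderiv]
    simpa using diff1 hF' hC w (w + -s)

set_option synthInstance.maxHeartbeats 400000 in
set_option maxSynthPendingDepth 6 in
lemma bound3 : ∃ C : ℝ, 0 ≤ C ∧ ∀ z, ‖fderiv ℝ (fderiv ℝ (fderiv ℝ (ph 1))) z‖ ≤ C := by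
  have h3 : ContDiff ℝ 3 (ph 1) := ph_contDiff 1 3
  have h2 : ContDiff ℝ 2 (fderiv ℝ (ph 1)) := h3.fderiv_right (by norm_num)
  have h1 : ContDiff ℝ 1 (fderiv ℝ (fderiv ℝ (ph 1))) := h2.fderiv_right (by norm_num)
  obtain ⟨C, hC⟩ := (h1.continuous_fderiv (by norm_num)).bounded_above_of_compact_support
    (((ph_supp 1).fderiv ℝ).fderiv ℝ |>.fderiv ℝ)
  exact ⟨C, (norm_nonneg _).trans (hC 0), hC⟩

/-- second difference of the bump -/
noncomputable def gg (p s y : E4) : ℝ := ph 1 (y + -p + s) + ph 1 (y + -p + -s) - 2 * ph 1 (y + -p)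

set_option synthInstance.maxHeartbeats 400000 in
set_option maxSynthPendingDepth 6 in
lemma gg_bound : ∃ C : ℝ, 0 ≤ C ∧ ∀ p s y y', |gg p s y - gg p s y'| ≤ C * ‖s‖ * ‖s‖ * ‖y - y'‖ := by
  obtain ⟨C, hC0, hC⟩ := bound3
  have h3 : ContDiff ℝ 3 (ph 1) := ph_contDiff 1 3
  have h2 : ContDiff ℝ 2 (fderiv ℝ (ph 1)) := h3.fderiv_right (by norm_num)
  have h1 : ContDiff ℝ 1 (fderiv ℝ (fderiv ℝ (ph 1))) := h2.fderiv_right (by norm_num)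
  have d0 := h3.differentiable (by norm_num)
  refine ⟨C, hC0, fun p s y y' => ?_⟩
  have hG : ∀ w, HasFDerivAt (gg p s) (fderiv ℝ (ph 1) (w + -p + s) + fderiv ℝ (ph 1) (w + -p + -s)
      - (2 : ℝ) • fderiv ℝ (ph 1) (w + -p)) w := by
    intro w
    have k1 := fderiv_shift d0 (-p + s) w
    have k2 := fderiv_shift d0 (-p + -s) w
    have k3 := fderiv_shift d0 (-p) w
    simp only [← add_assoc] at k1 k2
    exact (k1.add k2).sub (k3.const_mul 2)
  have := diff1 (F := gg p s) (C := C * ‖s‖ * ‖s‖) (fun w => (hG w).differentiableAt)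
    (fun w => ?_) y y'
  · exact this
  · rw [(hG w).fderiv]
    exact diff2 (h2.differentiable (by norm_num)) (h1.differentiable (by norm_num)) hC _ _

lemma gg_zero {p s y : E4} (h : ‖p‖ + ‖s‖ ≤ 1) (hy : 2 < ‖y‖) : gg p s y = 0 := by
  have a1 : 1 ≤ ‖y + -p + s‖ := by
    have := norm_add₃_le (a := y + -p + s) (b := p) (c := -s)
    rw [norm_neg, show y + -p + s + p + -s = y by abel] at this
    linarith
  have a2 : 1 ≤ ‖y + -p + -s‖ := by
    have := norm_add₃_le (a := y + -p + -s) (b := p) (c := s)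
    rw [show y + -p + -s + p + s = y by abel] at this
    linarith
  have a3 : 1 ≤ ‖y + -p‖ := by
    have := norm_add_le (y + -p) p
    rw [show y + -p + p = y by abel] at this
    linarith [norm_nonneg s]
  unfold gg
  rw [ph_zero (by nlinarith), ph_zero (by nlinarith), ph_zero (by nlinarith)]
  simp

/-- reflection in the first coordinate -/
noncomputable def sg : E4 ≃ₗᵢ[ℝ] E4 :=
  LinearIsometryEquiv.piLpCongrRight 2
    (fun i : Fin 4 => if i = 0 then LinearIsometryEquiv.neg ℝ else LinearIsometryEquiv.refl ℝ ℝ)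

lemma sg_apply (x : E4) (i : Fin 4) : sg x i = if i = 0 then - x i else x i := by
  unfold sg
  rw [LinearIsometryEquiv.piLpCongrRight_apply]
  by_cases h : i = 0 <;> simp [h]

lemma sg_zero (x : E4) : sg x 0 = - x 0 := by simp [sg_apply]

lemma sg_eq (x : E4) : sg x = x - (2 * x 0) • ee 0 := by
  ext i
  rw [sg_apply]
  by_cases h : i = 0
  · subst h; simp; ring
  · simp [h]

lemma sg_sg (x : E4) : sg (sg x) = x := by
  ext i
  simp only [sg_apply]
  split_ifs <;> simp

lemma second_diff {V : E4 → ℝ} {V' : E4 → E4 →L[ℝ] ℝ} {V'' : E4 → E4 →L[ℝ] E4 →L[ℝ] ℝ}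
    (h1 : ∀ x, HasFDerivAt V (V' x) x) (h2 : ∀ x, HasFDerivAt V' (V'' x) x)
    (hc : Continuous V'') (hh : ∀ x, ∑ i, V'' x (ee i) (ee i) = 0)
    (hodd : ∀ x, V (sg x) = - V x) (hpos : ∀ x : E4, 0 ≤ x 0 → 0 ≤ V x) (x h : E4) :
    V (x + h) + V (x - h) - 2 * V x = 0 := by
  have cV : Continuous V := continuous_iff_continuousAt.2 fun z => (h1 z).continuousAt
  have cV' : Continuous V' := continuous_iff_continuousAt.2 fun z => (h2 z).continuousAt
  have hsign : ∀ w : E4, 0 ≤ V w * w 0 := by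
    intro w
    rcases le_total 0 (w 0) with hw | hw
    · exact mul_nonneg (hpos w hw) hw
    · have := hpos (sg w) (by rw [sg_zero]; linarith)
      rw [hodd] at this
      nlinarith
  -- mean value
  set c : ℝ := ∫ z, ph 1 z with hcdef
  have hcpos : 0 < c := by
    refine (ph_cont 1).integral_pos_of_hasCompactSupport_nonneg_nonzero (ph_supp 1)
      (ph_nonneg 1) (x := 0) ?_
    exact (expNegInvGlue.pos_of_pos (by simp)).ne'
  have hI : ∀ (x : E4) (t : ℝ), ∫ z, V (x + t • z) * ph 1 z = V x * c := by
    intro x t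
    have hk : ∀ t : ℝ, HasDerivAt (fun t : ℝ => ∫ z, V (x + t • z) * ph 1 z) 0 t := by
      intro t
      simpa using key h1 h2 hc hh 1 x 1 0 t
    have := is_const_of_deriv_eq_zero (fun t => (hk t).differentiableAt) (fun t => (hk t).deriv) t 0
    simp only [zero_smul, add_zero] at this
    rw [this, integral_const_mul]
  -- first moment
  obtain ⟨A, hA⟩ : ∃ A : ℝ, ∀ t : ℝ, 0 < t → ∫ z, V (t • z) * (z 0 * ph 9 z) = A * t := by
    set J : ℝ → ℝ := fun t => ∫ z, V (t • z) * (z 0 * ph 9 z) with hJ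
    set M : ℝ → ℝ := fun t => ∫ z, V' (t • z) (ee 0) * ps 9 z with hM
    have hk : ∀ t : ℝ, HasDerivAt J (- M t) t := by
      intro t
      simpa using key h1 h2 hc hh 9 0 0 1 t
    have hJM : ∀ t, J t = - (t * M t) := by
      intro t
      have := integral_bilinear_hasFDerivAt_right_eq_neg_left_of_integrable (μ := volume)
        (B := ContinuousLinearMap.mul ℝ ℝ) (v := ee 0)
        (f := fun z : E4 => V (t • z)) (g := ps 9)
        (f' := fun z => t • V' (t • z))
        (g' := fun z => ph 9 z • innerSL ℝ z) ?_ ?_ ?_ (fun z _ => ?_)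
        (fun z _ => ps_hasFDerivAt 9 z)
      · simp only [ContinuousLinearMap.mul_apply', smul_eq_mul, smul_apply,
          mul_assoc, integral_const_mul] at this
        rw [hM, hJ]
        simp only
        rw [← this]
        refine integral_congr_ae (Eventually.of_forall fun z => ?_)
        simp [EuclideanSpace.inner_single_right, mul_comm (ph 9 z)]
      · refine int_ps (f := fun z => (t • V' (t • z)) (ee 0)) ?_
        fun_prop
      · have := int_ph (L := 9) (f := fun z => V (t • z) * z 0) (by fun_prop)
        refine this.congr (Eventually.of_forall fun z => ?_)
        simp [EuclideanSpace.inner_single_right]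
        ring
      · refine int_ps ?_
        fun_prop
      · have ha : HasFDerivAt (fun z : E4 => t • z) (t • ContinuousLinearMap.id ℝ E4) z :=
          (hasFDerivAt_id z).const_smul t
        refine ((h1 (t • z)).comp z ha).congr_fderiv ?_
        ext y
        simp
    have hq : ∀ t ∈ Set.Ioi (0 : ℝ), HasDerivAt (fun t => J t / t) 0 t := by
      intro t ht
      have := (hk t).div (hasDerivAt_id t) (ne_of_gt ht)
      have e0 : (-M t * id t - J t * 1) / id t ^ 2 = 0 := by
        rw [hJM t]
        simp only [id]
        ring
      rw [e0] at this
      exact this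
    refine ⟨J 1 / 1, fun t ht => ?_⟩
    have := isOpen_Ioi.is_const_of_deriv_eq_zero isPreconnected_Ioi
      (fun t ht => (hq t ht).differentiableAt.differentiableWithinAt) (fun t ht => (hq t ht).deriv)
      (Set.mem_Ioi.2 ht) (Set.mem_Ioi.2 one_pos)
    rw [← this]
    change J t = J t / t * t
    have := ht.ne'
    field_simp
  obtain ⟨C, hC0, hC⟩ := gg_bound
  set m : ℝ := expNegInvGlue 5 with hm
  have hmpos : 0 < m := expNegInvGlue.pos_of_pos (by norm_num)
  -- representation of the second difference
  have hrep : ∀ t : ℝ, 0 < t → c * (V (x + h) + V (x - h) - 2 * V x) =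
      ∫ y, V (t • y) * gg (t⁻¹ • x) (t⁻¹ • h) y := by
    intro t ht
    have hs : ∀ w : E4, V w * c = ∫ y, V (t • y) * ph 1 (y + - (t⁻¹ • w)) := by
      intro w
      rw [← hI w t, ← integral_add_right_eq_self (fun y => V (t • y) * ph 1 (y + - (t⁻¹ • w))) (t⁻¹ • w)]
      refine integral_congr_ae (Eventually.of_forall fun z => ?_)
      simp only [add_neg_cancel_right, smul_add, smul_smul, mul_inv_cancel₀ ht.ne', one_smul, add_comm w]
    have hitg : ∀ w : E4, Integrable (fun y => V (t • y) * ph 1 (y + - (t⁻¹ • w))) := by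
      intro w
      have := (int_ph (L := 1) (f := fun y => V (t • (y + t⁻¹ • w))) (by fun_prop)).comp_add_right (-(t⁻¹ • w))
      simpa using this
    have e : c * (V (x + h) + V (x - h) - 2 * V x) = V (x + h) * c + V (x - h) * c - 2 * (V x * c) := by
      ring
    rw [e, hs, hs, hs, ← integral_const_mul, ← integral_add (hitg _) (hitg _),
      ← integral_sub (by exact (hitg _).add (hitg _)) ((hitg _).const_mul 2)]
    refine integral_congr_ae (Eventually.of_forall fun z => ?_)
    simp only [gg]
    rw [show z + -(t⁻¹ • (x + h)) = z + -(t⁻¹ • x) + -(t⁻¹ • h) by rw [smul_add]; abel,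
      show z + -(t⁻¹ • (x - h)) = z + -(t⁻¹ • x) + (t⁻¹ • h) by rw [smul_sub]; abel]
    ring
  have hggc : ∀ p s, Continuous (gg p s) := by
    intro p s
    have := ph_cont 1
    unfold gg
    fun_prop
  have hbd : ∀ t : ℝ, ‖x‖ + ‖h‖ + 1 ≤ t → |2 * (c * (V (x + h) + V (x - h) - 2 * V x))| ≤
      (2 * C * ‖h‖ ^ 2 / m * A) / t := by
    intro t ht
    have ht0 : 0 < t := by linarith [norm_nonneg x, norm_nonneg h]
    set p := t⁻¹ • x with hp
    set s := t⁻¹ • h with hsdef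
    have hns : ‖s‖ = ‖h‖ / t := by
      rw [hsdef, norm_smul, norm_inv, Real.norm_of_nonneg ht0.le]; field_simp
    have hps : ‖p‖ + ‖s‖ ≤ 1 := by
      rw [hns, hp, norm_smul, norm_inv, Real.norm_of_nonneg ht0.le]
      rw [inv_mul_eq_div, ← add_div, div_le_one ht0]
      linarith
    have hitg : Integrable (fun y => V (t • y) * gg p s y) := by
      refine Continuous.integrable_of_hasCompactSupport (by have := hggc p s; fun_prop) ?_
      refine HasCompactSupport.intro (isCompact_closedBall (0 : E4) 2) fun z hz => ?_
      simp only [Metric.mem_closedBall, dist_zero_right, not_le] at hz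
      simp [gg_zero hps hz]
    have hmp : MeasurePreserving (sg : E4 → E4) := sg.measurePreserving
    have hrefl : ∫ y, V (t • y) * gg p s y = - ∫ y, V (t • y) * gg p s (sg y) := by
      rw [← hmp.integral_comp sg.toHomeomorph.measurableEmbedding, ← integral_neg]
      refine integral_congr_ae (Eventually.of_forall fun z => ?_)
      simp only
      rw [← map_smul, hodd]
      ring
    have hitgB : Integrable (fun y => V (t • y) * gg p s (sg y)) := by
      have := hmp.integrable_comp_of_integrable hitg
      refine this.neg.congr (Eventually.of_forall fun z => ?_)
      simp only [Function.comp, Pi.neg_apply]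
      rw [← map_smul, hodd]
      ring
    have h2c : 2 * (c * (V (x + h) + V (x - h) - 2 * V x)) =
        ∫ y, V (t • y) * (gg p s y - gg p s (sg y)) := by
      have : ∫ y, V (t • y) * (gg p s y - gg p s (sg y)) =
          (∫ y, V (t • y) * gg p s y) - ∫ y, V (t • y) * gg p s (sg y) := by
        rw [← integral_sub hitg hitgB]
        simp only [mul_sub]
      rw [this, hrep t ht0]
      linarith [hrefl]
    rw [h2c, ← Real.norm_eq_abs]
    have hdom : ∀ y : E4, ‖V (t • y) * (gg p s y - gg p s (sg y))‖ ≤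
        (2 * C * ‖h‖ ^ 2 / t ^ 2 / m) * (V (t • y) * (y 0 * ph 9 y)) := by
      intro y
      have hy0 : V (t • y) * y 0 = |V (t • y)| * |y 0| := by
        rw [← abs_mul, abs_of_nonneg]
        have := hsign (t • y)
        have e : V (t • y) * (t • y) 0 = t * (V (t • y) * y 0) := by simp; ring
        rw [e] at this
        exact nonneg_of_mul_nonneg_right this ht0
      rw [← mul_assoc (V _), hy0]
      rcases lt_or_ge 2 ‖y‖ with hy | hy
      · rw [gg_zero hps hy, gg_zero hps (by rwa [LinearIsometryEquiv.norm_map])]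
        have := ph_nonneg 9 y
        simp only [sub_zero, mul_zero, norm_zero]
        positivity
      · have hg := hC p s y (sg y)
        have e : ‖y - sg y‖ = 2 * |y 0| := by
          rw [sg_eq, sub_sub_cancel, norm_smul]
          simp
        rw [e, hns] at hg
        have hmle : m ≤ ph 9 y := expNegInvGlue.monotone (by nlinarith [norm_nonneg y])
        rw [norm_mul, Real.norm_eq_abs, Real.norm_eq_abs]
        calc |V (t • y)| * |gg p s y - gg p s (sg y)|
            ≤ |V (t • y)| * (C * (‖h‖ / t) * (‖h‖ / t) * (2 * |y 0|)) := by gcongr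
          _ = (2 * C * ‖h‖ ^ 2 / t ^ 2 / m) * (|V (t • y)| * |y 0| * m) := by
              field_simp
          _ ≤ _ := by gcongr
    refine (norm_integral_le_of_norm_le ?_ (Eventually.of_forall hdom)).trans ?_
    · refine Integrable.const_mul ?_ _
      have := int_ph (L := 9) (f := fun z => V (t • z) * z 0) (by fun_prop)
      simpa only [mul_assoc] using this
    · rw [integral_const_mul, hA t ht0]
      apply le_of_eq
      field_simp
  have hlim : Tendsto (fun t : ℝ => (2 * C * ‖h‖ ^ 2 / m * A) / t) atTop (𝓝 0) :=
    tendsto_const_nhds.div_atTop tendsto_id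
  have := ge_of_tendsto hlim (eventually_atTop.2 ⟨_, hbd⟩)
  have h0 := abs_nonpos_iff.1 this
  have h3 : c * (V (x + h) + V (x - h) - 2 * V x) = 0 := by linarith
  exact (mul_eq_zero.1 h3).resolve_left hcpos.ne'

lemma linear_of_second_diff {V : E4 → ℝ} (cV : Continuous V)
    (hS : ∀ x h, V (x + h) + V (x - h) - 2 * V x = 0) (h0 : ∀ x : E4, x 0 = 0 → V x = 0) (x : E4) :
    V x = V (ee 0) * x 0 := by
  have hz : V 0 = 0 := h0 0 (by simp)
  have hdbl : ∀ y, V (y + y) = 2 * V y := by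
    intro y
    have := hS y y
    rw [sub_self, hz] at this
    linarith
  have hadd : ∀ a b, V (a + b) = V a + V b := by
    intro a b
    have := hS (a + b) (a - b)
    rw [show a + b + (a - b) = a + a by abel, show a + b - (a - b) = b + b by abel, hdbl, hdbl] at this
    linarith
  let f : E4 →+ ℝ := { toFun := V, map_zero' := hz, map_add' := hadd }
  have hs : ∀ (r : ℝ) y, V (r • y) = r * V y := fun r y => map_real_smul f cV r y
  have : x = x 0 • ee 0 + (x - x 0 • ee 0) := by abel
  rw [this, hadd, hs, h0 (x - x 0 • ee 0) (by simp)]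
  simp
  ring

lemma proj_cont : Continuous fun x : E4 => x 0 := by fun_prop

lemma glue_deriv {G : Type*} [NormedAddCommGroup G] [NormedSpace ℝ G] {f g : E4 → G}
    {f' g' : E4 → E4 →L[ℝ] G} (hf : ∀ x : E4, 0 ≤ x 0 → HasFDerivAt f (f' x) x)
    (hg : ∀ x : E4, x 0 ≤ 0 → HasFDerivAt g (g' x) x) (h0 : ∀ x : E4, x 0 = 0 → f x = g x)
    (h0' : ∀ x : E4, x 0 = 0 → f' x = g' x) (x : E4) :
    HasFDerivAt (fun x : E4 => if 0 ≤ x 0 then f x else g x) (if 0 ≤ x 0 then f' x else g' x) x := by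
  rcases lt_trichotomy (x 0) 0 with h | h | h
  · rw [if_neg (not_le.2 h)]
    refine (hg x h.le).congr_of_eventuallyEq ?_
    filter_upwards [(isOpen_lt proj_cont continuous_const).mem_nhds h] with y hy
    rw [if_neg (not_le.2 hy)]
  · rw [if_pos h.ge, ← hasFDerivWithinAt_univ]
    have hu : (Set.univ : Set E4) = {y : E4 | 0 ≤ y 0} ∪ {y : E4 | y 0 ≤ 0} := by
      ext y
      simpa using le_total 0 (y 0)
    rw [hu]
    refine HasFDerivWithinAt.union ?_ ?_
    · refine (hf x h.ge).hasFDerivWithinAt.congr (fun y hy => if_pos hy) (if_pos h.ge)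
    · rw [h0' x h]
      refine (hg x h.le).hasFDerivWithinAt.congr (fun y hy => ?_) ?_
      · by_cases hy0 : 0 ≤ y 0
        · rw [if_pos hy0, h0 y (le_antisymm hy hy0)]
        · rw [if_neg hy0]
      · rw [if_pos h.ge, h0 x h]
  · rw [if_pos h.le]
    refine (hf x h.le).congr_of_eventuallyEq ?_
    filter_upwards [(isOpen_lt continuous_const proj_cont).mem_nhds h] with y hy
    rw [if_pos (le_of_lt hy)]

lemma glue_continuous {G : Type*} [TopologicalSpace G] {f g : E4 → G}
    (hf : ContinuousOn f {x : E4 | 0 ≤ x 0}) (hg : ContinuousOn g {x : E4 | x 0 ≤ 0})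
    (h0 : ∀ x : E4, x 0 = 0 → f x = g x) :
    Continuous (fun x : E4 => if 0 ≤ x 0 then f x else g x) := by
  refine continuous_if (fun a ha => h0 a ?_) (hf.mono ?_) (hg.mono ?_)
  · exact (frontier_le_subset_eq continuous_const proj_cont ha).symm
  · exact (isClosed_le continuous_const proj_cont).closure_subset
  · refine closure_minimal (fun y hy => ?_) (isClosed_le proj_cont continuous_const)
    exact (not_le.1 hy).le

/-- reflection as a continuous linear map -/
noncomputable def sL : E4 →L[ℝ] E4 := (sg.toContinuousLinearEquiv : E4 →L[ℝ] E4)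

lemma sL_apply (x : E4) : sL x = sg x := rfl

/-- pull back of functionals along the reflection -/
noncomputable def RR : (E4 →L[ℝ] ℝ) →L[ℝ] (E4 →L[ℝ] ℝ) :=
  (ContinuousLinearMap.compL ℝ E4 E4 ℝ).flip sL

lemma RR_apply (l : E4 →L[ℝ] ℝ) (x : E4) : RR l x = l (sg x) := rfl

lemma sg_ee_zero : sg (ee 0) = - ee 0 := by
  rw [sg_eq]
  simp
  module

lemma sg_ee {i : Fin 4} (h : i ≠ 0) : sg (ee i) = ee i := by
  rw [sg_eq]
  simp [h.symm]

lemma sg_tangent {x : E4} (h : x 0 = 0) : sg x = x := by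
  rw [sg_eq]
  simp [h]

set_option maxHeartbeats 1000000 in
lemma half_space {v : E4 → ℝ} {v' : E4 → E4 →L[ℝ] ℝ} {v'' : E4 → E4 →L[ℝ] E4 →L[ℝ] ℝ}
    (h1 : ∀ x : E4, 0 ≤ x 0 → HasFDerivAt v (v' x) x)
    (h2 : ∀ x : E4, 0 ≤ x 0 → HasFDerivAt v' (v'' x) x)
    (hc : ContinuousOn v'' {x : E4 | 0 ≤ x 0})
    (hh : ∀ x : E4, 0 < x 0 → ∑ i, v'' x (ee i) (ee i) = 0)
    (hb : ∀ x : E4, x 0 = 0 → v x = 0) (hpos : ∀ x : E4, 0 < x 0 → 0 ≤ v x) :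
    ∃ a : ℝ, 0 ≤ a ∧ ∀ x : E4, 0 ≤ x 0 → v x = a * x 0 := by
  have line : ∀ (x w : E4) (s : ℝ), HasDerivAt (fun s : ℝ => x + s • w) w s := by
    intro x w s
    simpa using ((hasDerivAt_id s).smul_const w).const_add x
  -- harmonic up to the boundary
  have hh' : ∀ x : E4, 0 ≤ x 0 → ∑ i, v'' x (ee i) (ee i) = 0 := by
    intro x hx
    have hcD : ContinuousOn (fun x => ∑ i, v'' x (ee i) (ee i)) {x : E4 | 0 ≤ x 0} := by
      fun_prop
    have hz : Set.EqOn (fun x : E4 => ∑ i, v'' x (ee i) (ee i)) (fun _ => 0)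
        {x : E4 | 0 < x 0} := fun y hy => hh y hy
    exact hz.of_subset_closure hcD continuousOn_const
      (fun y (hy : 0 < y 0) => (hy.le : 0 ≤ y 0)) (fun y hy => by
        have hl : Tendsto (fun s : ℝ => y + s • ee 0) (𝓝[>] 0) (𝓝 y) := by
          have := (line y (ee 0) 0).continuousAt.tendsto
          simp only [zero_smul, add_zero] at this
          exact this.mono_left nhdsWithin_le_nhds
        refine mem_closure_of_tendsto hl ?_
        filter_upwards [self_mem_nhdsWithin] with s hs
        have h1 : 0 < s := hs
        have h2 : 0 ≤ y 0 := hy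
        simp
        linarith) hx
  -- tangential derivatives
  have t1 : ∀ x w : E4, x 0 = 0 → w 0 = 0 → v' x w = 0 := by
    intro x w hx hw
    have hd : HasDerivAt (fun s : ℝ => v (x + s • w)) (v' x w) 0 := by
      have hx0 : HasFDerivAt v (v' x) (x + (0 : ℝ) • w) := by simpa using h1 x hx.ge
      exact hx0.comp_hasDerivAt (0 : ℝ) (line x w 0)
    have he : (fun s : ℝ => v (x + s • w)) = fun _ => 0 := by
      funext s
      exact hb _ (by simp [hx, hw])
    rw [he] at hd
    exact hd.unique (hasDerivAt_const _ _)
  have t2 : ∀ x w k : E4, x 0 = 0 → w 0 = 0 → k 0 = 0 → v'' x w k = 0 := by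
    intro x w k hx hw hk
    have hd : HasDerivAt (fun s : ℝ => v' (x + s • w) k) (v'' x w k) 0 := by
      have hx0 : HasFDerivAt v' (v'' x) (x + (0 : ℝ) • w) := by simpa using h2 x hx.ge
      exact (ContinuousLinearMap.apply ℝ ℝ k).hasFDerivAt.comp_hasDerivAt (0 : ℝ)
        (hx0.comp_hasDerivAt (0 : ℝ) (line x w 0))
    have he : (fun s : ℝ => v' (x + s • w) k) = fun _ => 0 := by
      funext s
      exact t1 _ _ (by simp [hx, hw]) hk
    rw [he] at hd
    exact hd.unique (hasDerivAt_const _ _)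
  have t3 : ∀ x : E4, x 0 = 0 → v'' x (ee 0) (ee 0) = 0 := by
    intro x hx
    have := hh' x hx.ge
    rw [Fin.sum_univ_four, t2 x (ee 1) (ee 1) hx (by simp) (by simp),
      t2 x (ee 2) (ee 2) hx (by simp) (by simp), t2 x (ee 3) (ee 3) hx (by simp) (by simp)] at this
    simpa using this
  have dec : ∀ x : E4, ∃ y : E4, y 0 = 0 ∧ x = x 0 • ee 0 + y ∧ sg x = -(x 0 • ee 0) + y := by
    intro x
    refine ⟨x - x 0 • ee 0, by simp, by abel, ?_⟩
    rw [sg_eq]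
    module
  -- the reflected function
  set g : E4 → ℝ := fun x => - v (sg x) with hg
  set g' : E4 → E4 →L[ℝ] ℝ := fun x => - RR (v' (sg x)) with hg'
  set g'' : E4 → E4 →L[ℝ] E4 →L[ℝ] ℝ := fun x => - (RR.comp ((v'' (sg x)).comp sL)) with hg''
  have hsgneg : ∀ x : E4, x 0 ≤ 0 → 0 ≤ (sg x) 0 := fun x hx => by rw [sg_zero]; linarith
  have dS : ∀ x : E4, HasFDerivAt (fun x : E4 => sg x) sL x := fun x => sL.hasFDerivAt
  have k1 : ∀ x : E4, x 0 ≤ 0 → HasFDerivAt g (g' x) x := by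
    intro x hx
    have := ((h1 (sg x) (hsgneg x hx)).comp x (dS x)).neg
    exact this
  have k2 : ∀ x : E4, x 0 ≤ 0 → HasFDerivAt g' (g'' x) x := by
    intro x hx
    have := (RR.hasFDerivAt.comp x ((h2 (sg x) (hsgneg x hx)).comp x (dS x))).neg
    exact this
  have m0 : ∀ x : E4, x 0 = 0 → v x = g x := by
    intro x hx
    simp only [hg]
    rw [sg_tangent hx, hb x hx, neg_zero]
  have m1 : ∀ x : E4, x 0 = 0 → v' x = g' x := by
    intro x hx
    ext w
    simp only [hg']
    rw [sg_tangent hx, neg_apply, RR_apply]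
    obtain ⟨y, hy, e1, e2⟩ := dec w
    rw [e2]
    conv_lhs => rw [e1]
    simp only [map_add, map_neg, t1 x y hx hy]
    ring
  have m2 : ∀ x : E4, x 0 = 0 → v'' x = g'' x := by
    intro x hx
    ext w k
    simp only [hg'']
    rw [sg_tangent hx]
    change v'' x w k = - (v'' x (sg w) (sg k))
    obtain ⟨y, hy, e1, e2⟩ := dec w
    obtain ⟨z, hz, f1, f2⟩ := dec k
    rw [e2, f2]
    conv_lhs => rw [e1, f1]
    simp only [map_add, map_neg, map_smul, add_apply, neg_apply, smul_apply,
      t2 x y z hx hy hz, t3 x hx, smul_eq_mul]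
    ring
  set V : E4 → ℝ := fun x => if 0 ≤ x 0 then v x else g x with hV
  set V' : E4 → E4 →L[ℝ] ℝ := fun x => if 0 ≤ x 0 then v' x else g' x with hV'
  set V'' : E4 → E4 →L[ℝ] E4 →L[ℝ] ℝ := fun x => if 0 ≤ x 0 then v'' x else g'' x with hV''
  have d1 : ∀ x, HasFDerivAt V (V' x) x := glue_deriv h1 k1 m0 m1
  have d2 : ∀ x, HasFDerivAt V' (V'' x) x := glue_deriv h2 k2 m1 m2
  have d3 : Continuous V'' := by
    refine glue_continuous hc ?_ m2
    have hcs : ContinuousOn (fun x => v'' (sg x)) {x : E4 | x 0 ≤ 0} :=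
      hc.comp sg.continuous.continuousOn (fun x hx => hsgneg x hx)
    simp only [hg'']
    exact (continuousOn_const.clm_comp (hcs.clm_comp continuousOn_const)).neg
  have d4 : ∀ x, ∑ i, V'' x (ee i) (ee i) = 0 := by
    intro x
    by_cases hx : 0 ≤ x 0
    · simp only [hV'', if_pos hx]
      exact hh' x hx
    · simp only [hV'', if_neg hx]
      have := hh' (sg x) (hsgneg x (le_of_not_ge hx))
      have e : ∀ i, g'' x (ee i) (ee i) = - v'' (sg x) (ee i) (ee i) := by
        intro i
        change - (v'' (sg x) (sg (ee i)) (sg (ee i))) = _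
        by_cases hi : i = 0
        · subst hi
          rw [sg_ee_zero]
          simp
        · rw [sg_ee hi]
      simp only [e, Finset.sum_neg_distrib, this, neg_zero]
  have vpos : ∀ x : E4, 0 ≤ x 0 → 0 ≤ v x := by
    intro x hx
    rcases hx.lt_or_eq with h | h
    · exact hpos x h
    · exact (hb x h.symm).ge
  have d5 : ∀ x, V (sg x) = - V x := by
    intro x
    simp only [hV, hg, sg_sg, sg_zero]
    rcases lt_trichotomy (x 0) 0 with h | h | h
    · rw [if_pos (by linarith), if_neg (by linarith), neg_neg]
    · rw [if_pos (by linarith), if_pos (by linarith), sg_tangent h, hb x h, neg_zero]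
    · rw [if_neg (by linarith), if_pos (by linarith)]
  have d6 : ∀ x : E4, 0 ≤ x 0 → 0 ≤ V x := by
    intro x hx
    simp only [hV, if_pos hx]
    exact vpos x hx
  have hlin := linear_of_second_diff (V := V)
    (continuous_iff_continuousAt.2 fun z => (d1 z).continuousAt)
    (second_diff d1 d2 d3 d4 d5 d6)
    (fun x hx => by simp only [hV, if_pos hx.ge]; exact hb x hx)
  refine ⟨V (ee 0), d6 _ (by simp), fun x hx => ?_⟩
  rw [← hlin x]
  simp only [hV, if_pos hx]

lemma lap_eq (u : E4 → ℝ) (x : E4) : lap u x = ∑ i, fderiv ℝ (fderiv ℝ u) x (ee i) (ee i) := by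
  unfold lap
  simp [iteratedFDeriv_two_apply]

/-- If `u` is smooth on a neighborhood of the closed half-space `{x₁ ≥ 0} ⊆ ℝ⁴`,
biharmonic on `{x₁ > 0}` with `Δu ≤ 0` there and `Δu = 0` on the boundary `{x₁ = 0}`,
then `Δu(x) = −a·x₁` for some constant `a ≥ 0`. -/
theorem laplacian_eq_neg_linear (u : EuclideanSpace ℝ (Fin 4) → ℝ)
    (hsmooth : ∃ U : Set (EuclideanSpace ℝ (Fin 4)), IsOpen U ∧
      {x : EuclideanSpace ℝ (Fin 4) | 0 ≤ x 0} ⊆ U ∧ ContDiffOn ℝ (⊤ : ℕ∞) u U)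
    (hbiharm : ∀ x : EuclideanSpace ℝ (Fin 4), 0 < x 0 → lap (lap u) x = 0)
    (hnonpos : ∀ x : EuclideanSpace ℝ (Fin 4), 0 < x 0 → lap u x ≤ 0)
    (hbdry : ∀ x : EuclideanSpace ℝ (Fin 4), x 0 = 0 → lap u x = 0) :
    ∃ a : ℝ, 0 ≤ a ∧ ∀ x : EuclideanSpace ℝ (Fin 4), 0 ≤ x 0 →
      lap u x = -a * x 0 := by
  obtain ⟨U, hU, hsub, hu⟩ := hsmooth
  have c1 : ContDiffOn ℝ 4 (fderiv ℝ u) U := (hu.of_le (WithTop.coe_le_coe.2 (le_top : (5 : ℕ∞) ≤ ⊤))).fderiv_of_isOpen (n := 5) hU (by norm_num)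
  have c2 : ContDiffOn ℝ 3 (fderiv ℝ (fderiv ℝ u)) U := c1.fderiv_of_isOpen hU (by norm_num)
  have c3 : ContDiffOn ℝ 3 (fun x => - lap u x) U := by
    simp only [lap_eq]
    refine (ContDiffOn.sum fun i _ => ?_).neg
    exact (c2.clm_apply contDiffOn_const).clm_apply contDiffOn_const
  have c4 : ContDiffOn ℝ 2 (fderiv ℝ (fun x => - lap u x)) U := c3.fderiv_of_isOpen hU (by norm_num)
  have c5 : ContDiffOn ℝ 1 (fderiv ℝ (fderiv ℝ (fun x => - lap u x))) U :=
    c4.fderiv_of_isOpen hU (by norm_num)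
  have hharm : ∀ x : E4, 0 < x 0 →
      ∑ i, fderiv ℝ (fderiv ℝ (fun x => - lap u x)) x (ee i) (ee i) = 0 := by
    intro x hx
    have e1 : fderiv ℝ (fun x => - lap u x) = fun x => - fderiv ℝ (lap u) x := by
      funext y
      exact fderiv_fun_neg
    have := hbiharm x hx
    rw [lap_eq] at this
    rw [e1]
    simp only [fderiv_fun_neg, neg_apply, Finset.sum_neg_distrib, this, neg_zero]
  obtain ⟨a, ha, h⟩ := half_space (v := fun x => - lap u x)
    (v' := fderiv ℝ (fun x => - lap u x)) (v'' := fderiv ℝ (fderiv ℝ (fun x => - lap u x)))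
    (fun x hx => ((c3.differentiableOn (by norm_num)).differentiableAt
      (hU.mem_nhds (hsub hx))).hasFDerivAt)
    (fun x hx => ((c4.differentiableOn (by norm_num)).differentiableAt
      (hU.mem_nhds (hsub hx))).hasFDerivAt)
    (c5.continuousOn.mono hsub) hharm (fun x hx => by simp [hbdry x hx])
    (fun x hx => by simpa using hnonpos x hx)
  refine ⟨a, ha, fun x hx => ?_⟩
  have := h x hx
  simp only at this
  linarith
end
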